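/- arXiv:2505.15750 — 8 statements merged into one kernel-verified Lean document; each statement's English description precedes it below -/
import Mathlib

section
/- Let M be a nonarchimedean normed abelian group, let M̂ denote its completion with canonical isometric embedding e : M → M̂, and let δ > 0. Then the map M / B_M(0,δ) → M̂ / B_{M̂}(0,δ) induced by e is a bijection, and it preserves the quotient norms: for every m ∈ M, inf{‖m + b‖ : b ∈ M, ‖b‖ < δ} = inf{‖e(m) + y‖ : y ∈ M̂, ‖y‖ < δ}. -/
/-- Let `M` be a nonarchimedean normed abelian group, `M̂` its completion
with canonical isometric embedding `e : M → M̂`, and `δ > 0`.  Then the map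
`M / B_M(0,δ) → M̂ / B_{M̂}(0,δ)` induced by `e` (on the quotients by the open-ball
equivalence relations) is a bijection, and it preserves the quotient norms:
`inf {‖m + b‖ : b ∈ M, ‖b‖ < δ} = inf {‖e m + y‖ : y ∈ M̂, ‖y‖ < δ}` for every `m ∈ M`. -/
theorem stmt2 {M : Type*} [NormedAddCommGroup M]
    (hna : ∀ x y : M, ‖x + y‖ ≤ max ‖x‖ ‖y‖) {δ : ℝ} (hδ : 0 < δ) :
    Function.Bijective
      (Quot.map (fun m : M => (m : UniformSpace.Completion M))
        (fun a b h => by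
          show ‖(a : UniformSpace.Completion M) - (b : UniformSpace.Completion M)‖ < δ
          rw [← UniformSpace.Completion.coe_sub, UniformSpace.Completion.norm_coe]
          exact h) :
        Quot (fun x y : M => ‖x - y‖ < δ) →
          Quot (fun x y : UniformSpace.Completion M => ‖x - y‖ < δ)) ∧
    ∀ m : M,
      sInf ((fun b : M => ‖m + b‖) '' {b : M | ‖b‖ < δ}) =
        sInf ((fun y : UniformSpace.Completion M => ‖(m : UniformSpace.Completion M) + y‖) ''
          {y : UniformSpace.Completion M | ‖y‖ < δ}) := by
  have hna' : ∀ x y : UniformSpace.Completion M, ‖x + y‖ ≤ max ‖x‖ ‖y‖ := by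
    intro x y
    induction x, y using UniformSpace.Completion.induction_on₂ with
    | hp => exact isClosed_le (by fun_prop) (by fun_prop)
    | ih a b =>
      rw [← UniformSpace.Completion.coe_add]
      simpa only [UniformSpace.Completion.norm_coe] using hna a b
  have hdense : ∀ (y : UniformSpace.Completion M) (ε : ℝ), 0 < ε →
      ∃ b : M, ‖y - (b : UniformSpace.Completion M)‖ < ε := by
    intro y ε hε
    obtain ⟨b, hb⟩ := UniformSpace.Completion.denseRange_coe.exists_dist_lt y hε
    exact ⟨b, by rwa [dist_eq_norm] at hb⟩
  have heq : Equivalence (fun x y : UniformSpace.Completion M => ‖x - y‖ < δ) := by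
    refine ⟨fun x => by simpa using hδ, fun {x y} h => by rwa [norm_sub_rev], ?_⟩
    intro x y z h1 h2
    have h := hna' (x - y) (y - z)
    rw [sub_add_sub_cancel] at h
    exact h.trans_lt (max_lt h1 h2)
  refine ⟨⟨?_, ?_⟩, ?_⟩
  · rintro ⟨a⟩ ⟨b⟩ h
    have h2 := heq.eqvGen_iff.1 (Quot.eqvGen_exact h)
    apply Quot.sound
    rw [← UniformSpace.Completion.coe_sub, UniformSpace.Completion.norm_coe] at h2
    exact h2
  · rintro ⟨y⟩
    obtain ⟨b, hb⟩ := hdense y δ hδ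
    refine ⟨Quot.mk _ b, Quot.sound ?_⟩
    rwa [norm_sub_rev]
  · intro m
    apply le_antisymm
    · apply le_csInf
      · exact ⟨_, 0, by simpa using hδ, rfl⟩
      rintro _ ⟨y, hy, rfl⟩
      have hy' : ‖y‖ < δ := hy
      apply le_of_forall_pos_le_add
      intro ε hε
      obtain ⟨b, hb⟩ := hdense y (min ε (δ - ‖y‖)) (lt_min hε (sub_pos.2 hy'))
      have hb1 := hb.trans_le (min_le_left _ _)
      have hb2 := hb.trans_le (min_le_right _ _)
      have hbn : ‖b‖ < δ := by
        rw [← UniformSpace.Completion.norm_coe b]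
        have := norm_sub_le y (y - (b : UniformSpace.Completion M))
        rw [sub_sub_cancel] at this
        linarith
      refine le_trans (csInf_le (a := ‖m + b‖) ⟨0, ?_⟩ ⟨b, hbn, rfl⟩) ?_
      · rintro _ ⟨c, _, rfl⟩
        exact norm_nonneg _
      · show ‖m + b‖ ≤ _
        rw [← UniformSpace.Completion.norm_coe (m + b), UniformSpace.Completion.coe_add]
        have := norm_sub_le ((m : UniformSpace.Completion M) + y)
          (y - (b : UniformSpace.Completion M))
        rw [add_sub_assoc, sub_sub_cancel] at this
        show _ ≤ ‖(m : UniformSpace.Completion M) + y‖ + ε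
        linarith
    · apply le_csInf
      · exact ⟨_, 0, by simpa using hδ, rfl⟩
      rintro _ ⟨b, hb, rfl⟩
      apply csInf_le ⟨0, ?_⟩
      · refine ⟨(b : UniformSpace.Completion M), ?_, ?_⟩
        · show ‖(b : UniformSpace.Completion M)‖ < δ
          rw [UniformSpace.Completion.norm_coe]
          exact hb
        · show ‖(m : UniformSpace.Completion M) + b‖ = ‖m + b‖
          rw [← UniformSpace.Completion.coe_add, UniformSpace.Completion.norm_coe]
      · rintro _ ⟨c, _, rfl⟩
        exact norm_nonneg _
end

section
/- Let f : M → N be a bounded ℂ-linear map between complex Banach spaces. Then the following are equivalent: (i) f is of order zero, i.e. for every p ∈ (0,1] there exist a bounded sequence (f_n) of continuous linear functionals on M, a bounded sequence (g_n) in N, and a sequence of scalars (λ_n) with Σ_n |λ_n|^p < ∞, such that f(x) = Σ_n λ_n f_n(x) g_n for all x ∈ M; (ii) f is factorisably trace-class, i.e. for every integer n ≥ 2 there exist complex Banach spaces Z_0 = M, Z_1, …, Z_{n-1}, Z_n = N and trace-class maps g_i : Z_{i-1} → Z_i (1 ≤ i ≤ n) with f = g_n ∘ ⋯ ∘ g_1.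 -/
/-- A bundled complex Banach space. -/
structure BanachC where
  carrier : Type
  [grp : NormedAddCommGroup carrier]
  [mod : NormedSpace ℂ carrier]
  [cpl : CompleteSpace carrier]

attribute [instance] BanachC.grp BanachC.mod BanachC.cpl

/-- A bounded `ℂ`-linear map `f` has a trace-class representation with coefficients of
finite `p`-th power sum: `f x = ∑ n, c n * φ n x • w n` with `(φ n)` a bounded sequence of
functionals, `(w n)` a bounded sequence of vectors and `∑ n, ‖c n‖ ^ p < ∞`. -/
def HasOrderRep (p : ℝ) {V W : Type*} [NormedAddCommGroup V] [NormedSpace ℂ V]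
    [NormedAddCommGroup W] [NormedSpace ℂ W] (f : V →L[ℂ] W) : Prop :=
  ∃ (φ : ℕ → (V →L[ℂ] ℂ)) (w : ℕ → W) (c : ℕ → ℂ),
    (∃ C : ℝ, ∀ n, ‖φ n‖ ≤ C) ∧ (∃ C : ℝ, ∀ n, ‖w n‖ ≤ C) ∧
    Summable (fun n => ‖c n‖ ^ p) ∧
    ∀ v : V, HasSum (fun n => (c n * (φ n) v) • w n) (f v)

/-- A bounded `ℂ`-linear map is trace-class if it has a representation
`f x = ∑ n, c n * φ n x • w n` with bounded `(φ n)`, `(w n)` and `∑ n, ‖c n‖ < ∞`. -/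
def IsTraceClassMap {V W : Type*} [NormedAddCommGroup V] [NormedSpace ℂ V]
    [NormedAddCommGroup W] [NormedSpace ℂ W] (f : V →L[ℂ] W) : Prop :=
  ∃ (φ : ℕ → (V →L[ℂ] ℂ)) (w : ℕ → W) (c : ℕ → ℂ),
    (∃ C : ℝ, ∀ n, ‖φ n‖ ≤ C) ∧ (∃ C : ℝ, ∀ n, ‖w n‖ ≤ C) ∧
    Summable (fun n => ‖c n‖) ∧
    ∀ v : V, HasSum (fun n => (c n * (φ n) v) • w n) (f v)

/-- `IsCompOfTraceClass n V W f` means that `f : V → W` can be written as a composition of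
`n` trace-class maps through intermediate complex Banach spaces. -/
inductive IsCompOfTraceClass :
    (n : ℕ) → (V : BanachC) → (W : BanachC) → (V.carrier →L[ℂ] W.carrier) → Prop
  | single (V W : BanachC) (f : V.carrier →L[ℂ] W.carrier) (hf : IsTraceClassMap f) :
      IsCompOfTraceClass 1 V W f
  | comp (n : ℕ) (V Z W : BanachC) (g : V.carrier →L[ℂ] Z.carrier)
      (h : Z.carrier →L[ℂ] W.carrier) (hg : IsTraceClassMap g)
      (hh : IsCompOfTraceClass n Z W h) :
      IsCompOfTraceClass (n + 1) V W (h.comp g)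


/-- The Hilbert space `ℓ²`. -/
abbrev H2 : Type := lp (fun _ : ℕ => ℂ) 2

lemma H2_hasSum (y : H2) : HasSum (fun k => ‖y k‖ ^ 2) (‖y‖ ^ 2) := by
  have h := lp.hasSum_norm (p := 2) (by norm_num) y
  simpa using h

lemma exists_A {V : Type*} [NormedAddCommGroup V] [NormedSpace ℂ V]
    (φ : ℕ → (V →L[ℂ] ℂ)) (C : ℝ) (hφ : ∀ n, ‖φ n‖ ≤ C) (a : ℕ → ℂ)
    (ha : Summable fun k => ‖a k‖ ^ 2) :
    ∃ A : V →L[ℂ] H2, ∀ x k, A x k = a k * φ k x := by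
  have hC : 0 ≤ C := (norm_nonneg _).trans (hφ 0)
  have hb : ∀ x k, ‖a k * φ k x‖ ^ 2 ≤ ‖a k‖ ^ 2 * (C * ‖x‖) ^ 2 := by
    intro x k
    rw [norm_mul, mul_pow]
    gcongr
    exact (φ k).le_of_opNorm_le (hφ k) x
  have hs : ∀ x, Summable fun k => ‖a k * φ k x‖ ^ 2 := fun x =>
    Summable.of_nonneg_of_le (fun k => by positivity) (hb x) (ha.mul_right _)
  have hm : ∀ x, Memℓp (fun k => a k * φ k x) 2 := fun x =>
    memℓp_gen (by simpa using hs x)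
  let L : V →ₗ[ℂ] H2 :=
    { toFun := fun x => ⟨fun k => a k * φ k x, hm x⟩
      map_add' := fun x y => by
        apply lp.ext
        funext k
        change a k * φ k (x + y) = a k * φ k x + a k * φ k y
        rw [map_add, mul_add]
      map_smul' := fun c x => by
        apply lp.ext
        funext k
        change a k * φ k (c • x) = c * (a k * φ k x)
        rw [map_smul, smul_eq_mul]; ring }
  refine ⟨L.mkContinuous (Real.sqrt (∑' k, ‖a k‖ ^ 2) * C) ?_, fun x k => rfl⟩
  intro x
  have h1 := (H2_hasSum (L x)).tsum_eq
  have h2 : ∑' k, ‖(L x) k‖ ^ 2 ≤ ∑' k, ‖a k‖ ^ 2 * (C * ‖x‖) ^ 2 :=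
    (hs x).tsum_le_tsum (hb x) (ha.mul_right _)
  rw [h1, tsum_mul_right] at h2
  refine abs_le_of_sq_le_sq' ?_ (by positivity) |>.2
  rw [mul_assoc, mul_pow, Real.sq_sqrt (tsum_nonneg fun k => by positivity)]
  exact h2

lemma exists_B {W : Type*} [NormedAddCommGroup W] [NormedSpace ℂ W] [CompleteSpace W]
    (w : ℕ → W) (C : ℝ) (hw : ∀ n, ‖w n‖ ≤ C) (b : ℕ → ℂ)
    (hb : Summable fun k => ‖b k‖ ^ 2) :
    ∃ B : H2 →L[ℂ] W, ∀ y : H2, HasSum (fun k => (b k * y k) • w k) (B y) := by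
  have hC : 0 ≤ C := (norm_nonneg _).trans (hw 0)
  have hH : ∀ y : H2, Summable (fun k => ‖b k‖ * ‖y k‖) ∧
      ∑' k, ‖b k‖ * ‖y k‖ ≤ Real.sqrt (∑' k, ‖b k‖ ^ 2) * ‖y‖ := by
    intro y
    have := Real.summable_and_inner_le_Lp_mul_Lq_tsum_of_nonneg Real.HolderConjugate.two_two
      (fun k => norm_nonneg (b k)) (fun k => norm_nonneg (y k)) (by simpa using hb)
      (by simpa using (H2_hasSum y).summable)
    refine ⟨this.1, this.2.trans_eq ?_⟩
    simp only [Real.rpow_two, ← Real.sqrt_eq_rpow]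
    rw [(H2_hasSum y).tsum_eq, Real.sqrt_sq (norm_nonneg y)]
  have hn : ∀ (y : H2) k, ‖(b k * y k) • w k‖ ≤ (‖b k‖ * ‖y k‖) * C := by
    intro y k
    rw [norm_smul, norm_mul]
    gcongr
    exact hw k
  have hs : ∀ y : H2, Summable fun k => (b k * y k) • w k := fun y =>
    Summable.of_norm_bounded ((hH y).1.mul_right C) (hn y)
  let L : H2 →ₗ[ℂ] W :=
    { toFun := fun y => ∑' k, (b k * y k) • w k
      map_add' := fun x y => by
        rw [← (hs x).tsum_add (hs y)]
        congr 1; funext k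
        rw [← add_smul, ← mul_add]; rfl
      map_smul' := fun c y => by
        rw [RingHom.id_apply, ← (hs y).tsum_const_smul c]
        congr 1; funext k
        rw [smul_smul]
        change (b k * (c * y k)) • w k = _
        congr 1; ring }
  refine ⟨L.mkContinuous (Real.sqrt (∑' k, ‖b k‖ ^ 2) * C) ?_, fun y => (hs y).hasSum⟩
  intro y
  have h1 : ‖L y‖ ≤ ∑' k, (‖b k‖ * ‖y k‖) * C :=
    tsum_of_norm_bounded ((hH y).1.mul_right C).hasSum (hn y)
  rw [tsum_mul_right] at h1
  refine h1.trans ?_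
  have := mul_le_mul_of_nonneg_right (hH y).2 hC
  linarith

lemma trace_factor {V W : Type*} [NormedAddCommGroup V] [NormedSpace ℂ V]
    [NormedAddCommGroup W] [NormedSpace ℂ W] [CompleteSpace W] (g : V →L[ℂ] W)
    (hg : IsTraceClassMap g) :
    ∃ (A : V →L[ℂ] H2) (B : H2 →L[ℂ] W) (φ : ℕ → (V →L[ℂ] ℂ)) (a : ℕ → ℂ) (C : ℝ),
      g = B.comp A ∧ (∀ n, ‖φ n‖ ≤ C) ∧ (Summable fun k => ‖a k‖ ^ 2) ∧
      ∀ x k, A x k = a k * φ k x := by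
  obtain ⟨φ, w, c, ⟨C, hφ⟩, ⟨D, hw⟩, hc, hg⟩ := hg
  let a : ℕ → ℂ := fun k => (Real.sqrt ‖c k‖ : ℂ)
  let b : ℕ → ℂ := fun k => c k / (Real.sqrt ‖c k‖ : ℂ)
  have hna : ∀ k, ‖a k‖ ^ 2 = ‖c k‖ := by
    intro k
    simp [a, Complex.norm_real, abs_of_nonneg (Real.sqrt_nonneg _), Real.sq_sqrt]
  have hnb : ∀ k, ‖b k‖ ^ 2 = ‖c k‖ := by
    intro k
    simp only [b, norm_div, Complex.norm_real, Real.norm_eq_abs,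
      abs_of_nonneg (Real.sqrt_nonneg _), Real.div_sqrt]
    rw [Real.sq_sqrt (norm_nonneg _)]
  have hab : ∀ k, b k * a k = c k := by
    intro k
    by_cases h : c k = 0
    · simp [a, b, h]
    · have : (Real.sqrt ‖c k‖ : ℂ) ≠ 0 := by
        rw [Ne, Complex.ofReal_eq_zero, Real.sqrt_eq_zero (norm_nonneg _)]
        simpa using h
      simp only [a, b]
      field_simp
  have hsa : Summable fun k => ‖a k‖ ^ 2 := by simpa only [hna] using hc
  have hsb : Summable fun k => ‖b k‖ ^ 2 := by simpa only [hnb] using hc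
  obtain ⟨A, hA⟩ := exists_A φ C hφ a hsa
  obtain ⟨B, hB⟩ := exists_B w D hw b hsb
  refine ⟨A, B, φ, a, C, ?_, hφ, hsa, hA⟩
  ext x
  refine (hg x).unique ?_
  have := hB (A x)
  simp only [hA, ← mul_assoc, hab] at this
  exact this

/-- Forward direction: order `1/n` gives a composition of `n` trace class maps. -/
lemma comp_of_rep (n : ℕ) : ∀ (V W : BanachC) (f : V.carrier →L[ℂ] W.carrier)
    (_ : HasOrderRep (1 / ((n : ℝ) + 1)) f), IsCompOfTraceClass (n + 1) V W f := by
  induction n with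
  | zero =>
    intro V W f h
    refine IsCompOfTraceClass.single V W f ?_
    simpa [HasOrderRep, IsTraceClassMap] using h
  | succ n ih =>
    intro V W f h
    obtain ⟨φ, w, c, ⟨C, hφ⟩, ⟨D, hw⟩, hc, hf⟩ := h
    push_cast at hc
    have hn1 : (0 : ℝ) < (n : ℝ) + 1 := by positivity
    have hn2 : (0 : ℝ) < (n : ℝ) + 1 + 1 := by positivity
    set q : ℝ := 1 / ((n : ℝ) + 1 + 1) with hq
    have hq0 : 0 < q := by positivity
    let a : ℕ → ℂ := fun k => ((‖c k‖ ^ q : ℝ) : ℂ)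
    let b : ℕ → ℂ := fun k => c k / ((‖c k‖ ^ q : ℝ) : ℂ)
    have hpos : ∀ k, 0 ≤ ‖c k‖ ^ q := fun k => by positivity
    have hna : ∀ k, ‖a k‖ = ‖c k‖ ^ q := by
      intro k
      simp only [a, Complex.norm_real, Real.norm_eq_abs, abs_of_nonneg (hpos k)]
    have hab : ∀ k, b k * a k = c k := by
      intro k
      by_cases h : c k = 0
      · simp [a, b, h]
      · have : ((‖c k‖ ^ q : ℝ) : ℂ) ≠ 0 := by
          rw [Ne, Complex.ofReal_eq_zero]
          have : 0 < ‖c k‖ := norm_pos_iff.2 h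
          positivity
        simp only [a, b]
        field_simp
    have hnb : ∀ k, ‖b k‖ ^ (1 / ((n : ℝ) + 1)) = ‖c k‖ ^ q := by
      intro k
      simp only [b, norm_div, Complex.norm_real, Real.norm_eq_abs, abs_of_nonneg (hpos k)]
      by_cases h : c k = 0
      · simp only [h, norm_zero, zero_div]
        rw [Real.zero_rpow (by positivity), Real.zero_rpow hq0.ne']
      · have h0 : 0 < ‖c k‖ := norm_pos_iff.2 h
        have : ‖c k‖ / ‖c k‖ ^ q = ‖c k‖ ^ (1 - q) := by
          rw [Real.rpow_sub h0, Real.rpow_one]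
        rw [this, ← Real.rpow_mul h0.le]
        congr 1
        rw [hq]; field_simp; ring
    have hsa : Summable fun k => ‖a k‖ := by simpa only [hna] using hc
    have hsb : Summable fun k => ‖b k‖ ^ (1 / ((n : ℝ) + 1)) := by simpa only [hnb] using hc
    have sq_of : ∀ u : ℕ → ℝ, (∀ k, 0 ≤ u k) → Summable u → Summable fun k => u k ^ 2 := by
      intro u hu h
      have h0 := h.tendsto_atTop_zero
      have h1 : ∀ᶠ k in Filter.atTop, u k < 1 := h0.eventually (gt_mem_nhds one_pos)
      refine Summable.of_norm_bounded_eventually_nat h ?_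
      filter_upwards [h1] with k hk
      rw [Real.norm_eq_abs, abs_of_nonneg (by positivity)]
      nlinarith [hu k]
    have hsb2 : Summable fun k => ‖b k‖ ^ 2 := by
      have h0 := hsb.tendsto_atTop_zero
      have h1 := h0.eventually (gt_mem_nhds one_pos)
      refine Summable.of_norm_bounded_eventually_nat hsb ?_
      filter_upwards [h1] with k hk
      rw [Real.norm_eq_abs, abs_of_nonneg (by positivity)]
      have hb1 : ‖b k‖ ≤ 1 := by
        by_contra hcon
        have := Real.one_le_rpow (le_of_lt (not_le.1 hcon)) (z := 1 / ((n : ℝ) + 1)) (by positivity)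
        linarith
      rcases (norm_nonneg (b k)).eq_or_lt with h | h
      · rw [← h]; simp; positivity
      rw [← Real.rpow_two]
      refine Real.rpow_le_rpow_of_exponent_ge h hb1 ?_
      rw [div_le_iff₀ hn1]; linarith
    obtain ⟨A, hA⟩ := exists_A φ C hφ a (sq_of _ (fun k => norm_nonneg _) hsa)
    obtain ⟨B, hB⟩ := exists_B w D hw b hsb2
    have hfac : f = B.comp A := by
      ext x
      refine (hf x).unique ?_
      have := hB (A x)
      simp only [hA, ← mul_assoc, hab] at this
      exact this
    rw [hfac]
    refine IsCompOfTraceClass.comp (n + 1) V ⟨H2⟩ W A B ?_ (ih ⟨H2⟩ W B ?_)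
    · refine ⟨φ, fun k => lp.single 2 k (1 : ℂ), a, ⟨C, hφ⟩, ⟨1, fun k => ?_⟩, hsa, fun x => ?_⟩
      · rw [lp.norm_single (by norm_num)]; simp
      · have := lp.hasSum_single (p := 2) (by norm_num) (A x)
        convert this using 2 with k
        rw [← lp.single_smul, hA]; simp
    · refine ⟨fun k => lp.evalCLM ℂ (fun _ : ℕ => ℂ) 2 k, w, b, ⟨1, fun k => ?_⟩, ⟨D, hw⟩, hsb, hB⟩
      refine ContinuousLinearMap.opNorm_le_bound _ zero_le_one fun y => ?_
      rw [one_mul]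
      exact lp.norm_apply_le_norm (by norm_num) y k

/-- Gelfand-number style smallness off a subspace of dimension at most `k`. -/
def Gelf {H W : Type*} [NormedAddCommGroup H] [InnerProductSpace ℂ H]
    [NormedAddCommGroup W] [NormedSpace ℂ W] (T : H →L[ℂ] W) (k ε : ℝ) : Prop :=
  ∃ E : Submodule ℂ H, FiniteDimensional ℂ E ∧ (Module.finrank ℂ E : ℝ) ≤ k ∧
    ∀ x ∈ Eᗮ, ‖T x‖ ≤ ε * ‖x‖

lemma Gelf.comp {H K W : Type*} [NormedAddCommGroup H] [InnerProductSpace ℂ H] [CompleteSpace H]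
    [NormedAddCommGroup K] [InnerProductSpace ℂ K] [CompleteSpace K]
    [NormedAddCommGroup W] [NormedSpace ℂ W] {T : H →L[ℂ] K} {S : K →L[ℂ] W} {k l ε δ : ℝ}
    (hδ : 0 ≤ δ) (hS : Gelf S l δ) (hT : Gelf T k ε) : Gelf (S.comp T) (k + l) (δ * ε) := by
  obtain ⟨E, hE, hEk, hET⟩ := hT
  obtain ⟨F, hF, hFl, hFS⟩ := hS
  refine ⟨E ⊔ F.map (T.adjoint : K →ₗ[ℂ] H), inferInstance, ?_, ?_⟩
  · have h1 := Submodule.finrank_add_le_finrank_add_finrank E (F.map (T.adjoint : K →ₗ[ℂ] H))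
    have h2 := Submodule.finrank_map_le (T.adjoint : K →ₗ[ℂ] H) F
    have h3 : (Module.finrank ℂ (E ⊔ F.map (T.adjoint : K →ₗ[ℂ] H) : Submodule ℂ H) : ℝ)
        ≤ Module.finrank ℂ E + Module.finrank ℂ F := by exact_mod_cast h1.trans (by omega)
    linarith
  · intro x hx
    have hxE : x ∈ Eᗮ := Submodule.orthogonal_le le_sup_left hx
    have hTx : T x ∈ Fᗮ := by
      rw [Submodule.mem_orthogonal]
      intro u hu
      rw [← ContinuousLinearMap.adjoint_inner_left]
      refine (Submodule.mem_orthogonal _ _).1 hx _ (Submodule.mem_sup_right ?_)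
      exact ⟨u, hu, rfl⟩
    calc ‖S (T x)‖ ≤ δ * ‖T x‖ := hFS _ hTx
      _ ≤ δ * (ε * ‖x‖) := by gcongr; exact hET x hxE
      _ = _ := by ring

lemma Gelf.post {H K W : Type*} [NormedAddCommGroup H] [InnerProductSpace ℂ H]
    [NormedAddCommGroup K] [NormedSpace ℂ K]
    [NormedAddCommGroup W] [NormedSpace ℂ W] {T : H →L[ℂ] K} (S : K →L[ℂ] W) {k ε : ℝ}
    (hT : Gelf T k ε) : Gelf (S.comp T) k (‖S‖ * ε) := by
  obtain ⟨E, hE, hEk, hET⟩ := hT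
  refine ⟨E, hE, hEk, fun x hx => ?_⟩
  calc ‖S (T x)‖ ≤ ‖S‖ * ‖T x‖ := S.le_opNorm _
    _ ≤ ‖S‖ * (ε * ‖x‖) := by gcongr; exact hET x hx
    _ = _ := by ring

lemma greedy {H K : Type*} [NormedAddCommGroup H] [InnerProductSpace ℂ H]
    [NormedAddCommGroup K] [NormedSpace ℂ K] (T : H →L[ℂ] K) (S : ℝ)
    (hS : ∀ s : Finset H, Orthonormal ℂ (fun e : s => (e : H)) → ∑ e ∈ s, ‖T e‖ ^ 2 ≤ S)
    (ε : ℝ) (hε : 0 < ε) : Gelf T (S / ε ^ 2) ε := by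
  classical
  let P : ℕ → Prop := fun n => ∃ s : Finset H, Orthonormal ℂ (fun e : s => (e : H)) ∧
    (∀ e ∈ s, ε < ‖T e‖) ∧ s.card = n
  have hcard : ∀ n, P n → (n : ℝ) ≤ S / ε ^ 2 := by
    rintro n ⟨s, hs, hT, rfl⟩
    rw [le_div_iff₀ (by positivity)]
    refine le_trans ?_ (hS s hs)
    rw [← nsmul_eq_mul]
    refine Finset.card_nsmul_le_sum _ _ _ fun e he => ?_
    have := hT e he
    gcongr
  have hP0 : P 0 := ⟨∅, by
    refine ⟨fun e => absurd e.2 (Finset.notMem_empty _), fun e => absurd e.2 (Finset.notMem_empty _)⟩,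
    by simp, rfl⟩
  let N := Nat.findGreatest P ⌊S / ε ^ 2⌋₊
  have hPN : P N := Nat.findGreatest_spec (Nat.zero_le _) hP0
  have hmax : ¬ P (N + 1) := by
    intro h
    have := Nat.le_findGreatest (Nat.le_floor (hcard _ h)) h
    change N + 1 ≤ N at this
    omega
  have hNle := hcard N hPN
  obtain ⟨s, hs, hsT, hsN⟩ := hPN
  refine ⟨Submodule.span ℂ (s : Set H), FiniteDimensional.span_finset ℂ s, ?_, ?_⟩
  · have := finrank_span_finset_le_card (R := ℂ) s
    rw [Set.finrank, hsN] at this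
    exact le_trans (by exact_mod_cast this) hNle
  · intro x hx
    by_contra hcon
    push Not at hcon
    apply hmax
    have hx0 : x ≠ 0 := by rintro rfl; simp at hcon
    have hxn : 0 < ‖x‖ := norm_pos_iff.2 hx0
    let y : H := ((‖x‖⁻¹ : ℝ) : ℂ) • x
    have hy1 : ‖y‖ = 1 := by
      simp only [y, norm_smul, Complex.norm_real, norm_inv, norm_norm]
      field_simp
    have hyT : ε < ‖T y‖ := by
      simp only [y, map_smul, norm_smul, Complex.norm_real, norm_inv, norm_norm]
      rw [inv_mul_eq_div, lt_div_iff₀ hxn]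
      exact hcon
    have hyo : ∀ e ∈ s, inner ℂ e y = 0 := by
      intro e he
      have := (Submodule.mem_orthogonal _ _).1 hx e (Submodule.subset_span he)
      simp [y, this]
    have hys : y ∉ s := by
      intro h
      have := hyo y h
      rw [inner_self_eq_zero] at this
      rw [this, norm_zero] at hy1
      exact zero_ne_one hy1
    refine ⟨insert y s, ⟨?_, ?_⟩, ?_, ?_⟩
    · rintro ⟨e, he⟩
      rcases Finset.mem_insert.1 he with rfl | h
      · exact hy1
      · exact hs.1 ⟨e, h⟩
    · rintro ⟨e, he⟩ ⟨e', he'⟩ hne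
      have hne' : e ≠ e' := fun h => hne (Subtype.ext h)
      change inner ℂ e e' = 0
      rcases Finset.mem_insert.1 he with h | h <;> rcases Finset.mem_insert.1 he' with h' | h'
      · exact absurd (h.trans h'.symm) hne'
      · rw [h, inner_eq_zero_symm]; exact hyo e' h'
      · rw [h']; exact hyo e h
      · exact hs.2 (i := ⟨e, h⟩) (j := ⟨e', h'⟩) (fun h => hne' (congrArg Subtype.val h))
    · intro e he
      rcases Finset.mem_insert.1 he with rfl | h
      · exact hyT
      · exact hsT e h
    · rw [Finset.card_insert_of_notMem hys, hsN]

lemma gelf_A {V : Type*} [NormedAddCommGroup V] [NormedSpace ℂ V]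
    (φ : ℕ → (V →L[ℂ] ℂ)) (C : ℝ) (hφ : ∀ n, ‖φ n‖ ≤ C) (a : ℕ → ℂ)
    (ha : Summable fun k => ‖a k‖ ^ 2) (A : V →L[ℂ] H2) (hA : ∀ x k, A x k = a k * φ k x)
    (B : H2 →L[ℂ] V) : ∃ S : ℝ, 0 ≤ S ∧ ∀ ε : ℝ, 0 < ε → Gelf (A.comp B) (S / ε ^ 2) ε := by
  have hC : 0 ≤ C := (norm_nonneg _).trans (hφ 0)
  refine ⟨∑' k, ‖a k‖ ^ 2 * (C * ‖B‖) ^ 2, tsum_nonneg fun k => by positivity,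
    fun ε hε => greedy _ _ ?_ ε hε⟩
  intro s hs
  have h1 : HasSum (fun k => ∑ e ∈ s, ‖(A (B e)) k‖ ^ 2) (∑ e ∈ s, ‖A (B e)‖ ^ 2) :=
    hasSum_sum fun e _ => H2_hasSum (A (B e))
  change ∑ e ∈ s, ‖A (B e)‖ ^ 2 ≤ _
  rw [← h1.tsum_eq]
  refine h1.summable.tsum_le_tsum (fun k => ?_) (ha.mul_right _)
  simp only [hA, norm_mul, mul_pow]
  rw [← Finset.mul_sum, ← mul_pow]
  gcongr
  let v : H2 := (InnerProductSpace.toDual ℂ H2).symm ((φ k).comp B)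
  have hv : ∀ e, φ k (B e) = inner ℂ v e := fun e => by
    simp only [v, InnerProductSpace.toDual_symm_apply]; rfl
  have hvn : ‖v‖ ≤ C * ‖B‖ := by
    simp only [v, LinearIsometryEquiv.norm_map]
    refine (ContinuousLinearMap.opNorm_comp_le _ _).trans ?_
    gcongr
    exact hφ k
  have hb := hs.sum_inner_products_le v (s := Finset.univ)
  rw [Finset.sum_coe_sort s (fun e : H2 => ‖inner ℂ e v‖ ^ 2)] at hb
  simp only [hv]
  calc ∑ e ∈ s, ‖inner ℂ v e‖ ^ 2 = ∑ e ∈ s, ‖inner ℂ e v‖ ^ 2 := by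
        refine Finset.sum_congr rfl fun e _ => ?_
        rw [norm_inner_symm]
    _ ≤ ‖v‖ ^ 2 := hb
    _ ≤ _ := by gcongr

lemma gelf_comp {n : ℕ} {Z W : BanachC} {h : Z.carrier →L[ℂ] W.carrier}
    (hh : IsCompOfTraceClass n Z W h) : ∀ B : H2 →L[ℂ] Z.carrier,
    ∃ C D : ℝ, 0 ≤ C ∧ 0 ≤ D ∧
      ∀ j : ℕ, Gelf (h.comp B) (C * 4 ^ j) (D * ((1 / 2 : ℝ) ^ j) ^ n) := by
  have key : ∀ (S : ℝ) (j : ℕ), S / ((1 / 2 : ℝ) ^ j) ^ 2 = S * 4 ^ j := by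
    intro S j
    rw [← pow_mul, mul_comm j 2, pow_mul, div_eq_mul_inv, ← inv_pow]
    norm_num
  induction hh with
  | single V W f hf =>
    intro B
    obtain ⟨A, B', φ, a, C, hg, hφ, ha, hA⟩ := trace_factor f hf
    obtain ⟨S, hS0, hS⟩ := gelf_A φ C hφ a ha A hA B
    refine ⟨S, ‖B'‖, hS0, norm_nonneg _, fun j => ?_⟩
    have := (hS ((1 / 2 : ℝ) ^ j) (by positivity)).post B'
    rw [key] at this
    rw [hg, pow_one]
    exact this
  | comp n V Z W g h hg hh ih =>
    intro B
    obtain ⟨A, B', φ, a, C, hg, hφ, ha, hA⟩ := trace_factor g hg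
    obtain ⟨S, hS0, hS⟩ := gelf_A φ C hφ a ha A hA B
    obtain ⟨C', D, hC', hD, hG⟩ := ih B'
    refine ⟨S + C', D, by positivity, hD, fun j => ?_⟩
    have := Gelf.comp (by positivity) (hG j) (hS ((1 / 2 : ℝ) ^ j) (by positivity))
    rw [key, ← add_mul, mul_assoc, ← pow_succ] at this
    rw [hg]
    exact this

lemma rep_of_countable {V W : Type*} [NormedAddCommGroup V] [NormedSpace ℂ V]
    [NormedAddCommGroup W] [NormedSpace ℂ W] (f : V →L[ℂ] W) (p : ℝ) (hp : 0 < p)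
    {ι : Type*} [Countable ι] (φ : ι → (V →L[ℂ] ℂ)) (w : ι → W) (c : ι → ℂ)
    (C D : ℝ) (hφ : ∀ i, ‖φ i‖ ≤ C) (hw : ∀ i, ‖w i‖ ≤ D)
    (hc : Summable fun i => ‖c i‖ ^ p)
    (hf : ∀ v, HasSum (fun i => (c i * φ i v) • w i) (f v)) : HasOrderRep p f := by
  classical
  obtain ⟨e, he⟩ := Countable.exists_injective_nat ι
  have hout : ∀ n, n ∉ Set.range e → Function.extend e c 0 n = 0 := by
    intro n hn
    rw [Function.extend_apply' _ _ _ (by simpa using hn)]; rfl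
  refine ⟨Function.extend e φ 0, Function.extend e w 0, Function.extend e c 0,
    ⟨max C 0, fun n => ?_⟩, ⟨max D 0, fun n => ?_⟩, ?_, fun v => ?_⟩
  · by_cases hn : ∃ i, e i = n
    · obtain ⟨i, rfl⟩ := hn
      rw [he.extend_apply]
      exact (hφ i).trans (le_max_left _ _)
    · rw [Function.extend_apply' _ _ _ hn]; simp
  · by_cases hn : ∃ i, e i = n
    · obtain ⟨i, rfl⟩ := hn
      rw [he.extend_apply]
      exact (hw i).trans (le_max_left _ _)
    · rw [Function.extend_apply' _ _ _ hn]; simp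
  · rw [← he.summable_iff]
    · refine hc.congr fun i => ?_
      simp only [Function.comp, he.extend_apply]
    · intro n hn
      rw [hout n hn, norm_zero, Real.zero_rpow hp.ne']
  · rw [← he.hasSum_iff]
    · convert hf v using 2 with i
      simp only [Function.comp, he.extend_apply]
    · intro n hn
      rw [hout n hn, zero_mul, zero_smul]

lemma rep_of_gelf {W : Type*} [NormedAddCommGroup W] [NormedSpace ℂ W] [CompleteSpace W]
    (U : H2 →L[ℂ] W) (C D : ℝ) (hC : 0 ≤ C) (hD : 0 ≤ D) (n : ℕ)
    (hG : ∀ j : ℕ, Gelf U (C * 4 ^ j) (D * ((1 / 2 : ℝ) ^ j) ^ n))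
    (p : ℝ) (hp : 0 < p) (hp1 : p ≤ 1) (hnp : 2 < n * p) : HasOrderRep p U := by
  -- normalise so that the zeroth subspace is trivial
  obtain ⟨D', hD', E, hEf, hEd, hEU, hE0⟩ : ∃ D' : ℝ, 0 < D' ∧ ∃ E : ℕ → Submodule ℂ H2,
      (∀ j, FiniteDimensional ℂ (E j)) ∧ (∀ j, (Module.finrank ℂ (E j) : ℝ) ≤ C * 4 ^ j) ∧
      (∀ j, ∀ x ∈ (E j)ᗮ, ‖U x‖ ≤ D' * ((1 / 2 : ℝ) ^ j) ^ n * ‖x‖) ∧ E 0 = ⊥ := by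
    choose E hE using hG
    let E' : ℕ → Submodule ℂ H2 := fun j => Nat.casesOn j ⊥ (fun k => E (k + 1))
    refine ⟨D + ‖U‖ + 1, by positivity, E', ?_, ?_, ?_, rfl⟩
    · rintro (_ | k)
      · change FiniteDimensional ℂ (⊥ : Submodule ℂ H2); infer_instance
      · exact (hE (k + 1)).1
    · rintro (_ | k)
      · change (Module.finrank ℂ (⊥ : Submodule ℂ H2) : ℝ) ≤ _
        simp [hC]
      · exact (hE (k + 1)).2.1
    · rintro (_ | k) x hx
      · simp only [pow_zero, one_pow, mul_one]
        refine (U.le_opNorm x).trans ?_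
        gcongr
        linarith
      · refine ((hE (k + 1)).2.2 x hx).trans ?_
        gcongr
        linarith [norm_nonneg U]
  set θ : ℝ := (1 / 2 : ℝ) ^ n with hθ
  have hθ0 : 0 < θ := by positivity
  have hpw : ∀ j : ℕ, ((1 / 2 : ℝ) ^ j) ^ n = θ ^ j := fun j => by rw [hθ, pow_right_comm]
  simp only [hpw] at hEU
  have hθ1 : θ ≤ 1 := pow_le_one₀ (by norm_num) (by norm_num)
  let Q : ℕ → (H2 →L[ℂ] H2) := fun j => (E j).starProjection
  let Δ : ℕ → (H2 →L[ℂ] W) := fun j => U.comp (Q (j + 1)) - U.comp (Q j)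
  let F : ℕ → Submodule ℂ H2 := fun j => E j ⊔ E (j + 1)
  have hFf : ∀ j, FiniteDimensional ℂ (F j) := fun j => by dsimp only [F]; infer_instance
  let r : ℕ → ℝ := fun j => 2 * D' * θ ^ j
  have hr : ∀ j, 0 < r j := fun j => by positivity
  have hQ : ∀ j x, ‖U (x - Q j x)‖ ≤ D' * θ ^ j * ‖x‖ := by
    intro j x
    have hmem : x - Q j x ∈ (E j)ᗮ := Submodule.sub_starProjection_mem_orthogonal x
    refine (hEU j _ hmem).trans ?_
    gcongr
    have h1 : x - Q j x = (E j)ᗮ.starProjection x := by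
      rw [Submodule.starProjection_orthogonal_val]
    rw [h1]
    exact Submodule.norm_starProjection_apply_le _ x
  have hΔ : ∀ j x, ‖Δ j x‖ ≤ r j * ‖x‖ := by
    intro j x
    have h1 : Δ j x = U (x - Q j x) - U (x - Q (j + 1) x) := by
      simp [Δ]
    rw [h1]
    refine (norm_sub_le _ _).trans ?_
    have h2 : D' * θ ^ (j + 1) * ‖x‖ ≤ D' * θ ^ j * ‖x‖ := by
      gcongr ?_ * ?_ * _
      exact pow_le_pow_of_le_one hθ0.le hθ1 (Nat.le_succ j)
    have h3 := hQ j x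
    have h4 := hQ (j + 1) x
    simp only [r]
    linarith
  let d : ℕ → ℕ := fun j => Module.finrank ℂ (F j)
  have hd : ∀ j, (d j : ℝ) ≤ 5 * C * 4 ^ j := by
    intro j
    have h1 := Submodule.finrank_add_le_finrank_add_finrank (E j) (E (j + 1))
    have h2 : (d j : ℝ) ≤ Module.finrank ℂ (E j) + Module.finrank ℂ (E (j + 1)) := by
      exact_mod_cast h1
    have h3 := hEd j
    have h4 := hEd (j + 1)
    rw [pow_succ] at h4
    linarith
  let b : ∀ j, OrthonormalBasis (Fin (d j)) ℂ (F j) := fun j => stdOrthonormalBasis ℂ (F j)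
  have hbn : ∀ j i, ‖((b j i : F j) : H2)‖ = 1 := fun j i => (b j).orthonormal.1 i
  have hexp : ∀ j x, Δ j x = ∑ i, inner ℂ ((b j i : F j) : H2) x • Δ j ((b j i : F j) : H2) := by
    intro j x
    have h1 : (F j).starProjection x = ∑ i, inner ℂ ((b j i : F j) : H2) x • ((b j i : F j) : H2) := by
      rw [(b j).starProjection_eq_sum_rankOne]
      simp
    have h2 : x - (F j).starProjection x ∈ (F j)ᗮ := Submodule.sub_starProjection_mem_orthogonal x
    have h3 : Δ j (x - (F j).starProjection x) = 0 := by
      have e1 : Q j (x - (F j).starProjection x) = 0 :=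
        (Submodule.starProjection_apply_eq_zero_iff _).2 (Submodule.orthogonal_le le_sup_left h2)
      have e2 : Q (j + 1) (x - (F j).starProjection x) = 0 :=
        (Submodule.starProjection_apply_eq_zero_iff _).2 (Submodule.orthogonal_le le_sup_right h2)
      change U (Q (j + 1) _) - U (Q j _) = 0
      rw [e1, e2]; simp
    rw [map_sub, sub_eq_zero, h1, map_sum] at h3
    simpa only [map_smul] using h3
  have hsum : ∀ q : ℝ, 0 < q → 2 < n * q → Summable fun i : (Σ j, Fin (d j)) => (r i.1) ^ q := by
    intro q hq hnq
    rw [summable_sigma_of_nonneg (fun i => by have := hr i.1; positivity)]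
    refine ⟨fun j => Summable.of_finite, ?_⟩
    simp only [tsum_fintype, Finset.sum_const, Finset.card_univ, Fintype.card_fin, nsmul_eq_mul]
    have hratio : 4 * θ ^ q < 1 := by
      have e1 : θ ^ q = (1 / 2 : ℝ) ^ ((n : ℝ) * q) := by
        rw [hθ, ← Real.rpow_natCast, ← Real.rpow_mul (by norm_num)]
      have e2 : (1 / 2 : ℝ) ^ ((n : ℝ) * q) < (1 / 2 : ℝ) ^ (2 : ℝ) :=
        Real.rpow_lt_rpow_of_exponent_gt (by norm_num) (by norm_num) hnq
      rw [e1]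
      norm_num at e2 ⊢
      linarith
    have hgeo := (summable_geometric_of_lt_one (by positivity) hratio).mul_left
      (5 * C * (2 * D') ^ q)
    refine Summable.of_nonneg_of_le (fun j => by have := hr j; positivity) (fun j => ?_) hgeo
    have e3 : (r j) ^ q = (2 * D') ^ q * (θ ^ q) ^ j := by
      simp only [r]
      rw [Real.mul_rpow (by positivity) (by positivity), ← Real.rpow_natCast, ← Real.rpow_natCast,
        ← Real.rpow_mul hθ0.le, ← Real.rpow_mul hθ0.le, mul_comm q]
    rw [e3, mul_pow]
    calc (d j : ℝ) * ((2 * D') ^ q * (θ ^ q) ^ j)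
        ≤ (5 * C * 4 ^ j) * ((2 * D') ^ q * (θ ^ q) ^ j) := by gcongr; exact hd j
      _ = _ := by ring
  have hn2 : (2 : ℝ) < n * 1 := by
    have : (n : ℝ) * p ≤ n * 1 := by gcongr
    linarith
  have hθlt : θ < 1 := by
    refine pow_lt_one₀ (by norm_num) (by norm_num) ?_
    rintro rfl
    norm_num at hn2
  refine rep_of_countable U p hp (ι := Σ j, Fin (d j))
    (fun i => innerSL ℂ ((b i.1 i.2 : F i.1) : H2))
    (fun i => ((r i.1)⁻¹ : ℂ) • Δ i.1 ((b i.1 i.2 : F i.1) : H2))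
    (fun i => (r i.1 : ℂ)) 1 1 ?_ ?_ ?_ ?_
  · intro i
    rw [innerSL_apply_norm, hbn]
  · intro i
    have h0 := hr i.1
    have h1 := hΔ i.1 ((b i.1 i.2 : F i.1) : H2)
    rw [hbn, mul_one] at h1
    rw [norm_smul, norm_inv, Complex.norm_real, Real.norm_eq_abs, abs_of_pos h0,
      inv_mul_le_iff₀ h0, mul_one]
    exact h1
  · refine (hsum p hp hnp).congr fun i => ?_
    rw [Complex.norm_real, Real.norm_eq_abs, abs_of_pos (hr i.1)]
  · intro x
    have hterm : ∀ i : (Σ j, Fin (d j)),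
        ((r i.1 : ℂ) * innerSL ℂ ((b i.1 i.2 : F i.1) : H2) x) •
          (((r i.1)⁻¹ : ℂ) • Δ i.1 ((b i.1 i.2 : F i.1) : H2)) =
        inner ℂ ((b i.1 i.2 : F i.1) : H2) x • Δ i.1 ((b i.1 i.2 : F i.1) : H2) := by
      intro i
      have : (r i.1 : ℂ) ≠ 0 := by exact_mod_cast (hr i.1).ne'
      rw [smul_smul, innerSL_apply_apply]
      congr 1
      field_simp
    simp only [hterm]
    have hS : Summable fun i : (Σ j, Fin (d j)) =>
        inner ℂ ((b i.1 i.2 : F i.1) : H2) x • Δ i.1 ((b i.1 i.2 : F i.1) : H2) := by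
      have h1 := (hsum 1 one_pos hn2).mul_left ‖x‖
      refine Summable.of_norm_bounded h1 fun i => ?_
      rw [norm_smul, Real.rpow_one]
      have h2 := norm_inner_le_norm (𝕜 := ℂ) ((b i.1 i.2 : F i.1) : H2) x
      have h3 := hΔ i.1 ((b i.1 i.2 : F i.1) : H2)
      rw [hbn, one_mul] at h2
      rw [hbn, mul_one] at h3
      gcongr
    have h4 : HasSum (fun j => Δ j x) (∑' i : (Σ j, Fin (d j)),
        inner ℂ ((b i.1 i.2 : F i.1) : H2) x • Δ i.1 ((b i.1 i.2 : F i.1) : H2)) := by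
      refine hS.hasSum.sigma fun j => ?_
      rw [hexp j x]
      exact hasSum_fintype _
    have h5 := h4.tendsto_sum_nat
    have h6 : Filter.Tendsto (fun N => ∑ j ∈ Finset.range N, Δ j x) Filter.atTop (nhds (U x)) := by
      have e1 : ∀ N, ∑ j ∈ Finset.range N, Δ j x = U x - U (x - Q N x) := by
        intro N
        have e2 : ∑ j ∈ Finset.range N, Δ j x = U (Q N x) - U (Q 0 x) :=
          Finset.sum_range_sub (fun j => U (Q j x)) N
        have e3 : Q 0 x = 0 := by
          simp only [Q]
          rw [Submodule.starProjection_apply_eq_zero_iff, hE0]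
          simp
        rw [e2, e3]; simp
      simp only [e1]
      have e4 : Filter.Tendsto (fun N => U (x - Q N x)) Filter.atTop (nhds 0) := by
        refine squeeze_zero_norm (fun N => hQ N x) ?_
        have := ((tendsto_pow_atTop_nhds_zero_of_lt_one hθ0.le hθlt).const_mul D').mul_const ‖x‖
        simpa using this
      have e5 := (tendsto_const_nhds (x := U x)).sub e4
      rwa [sub_zero] at e5
    have := tendsto_nhds_unique h5 h6
    rw [← this]
    exact hS.hasSum

lemma rep_of_comp {m : ℕ} {p : ℝ} (hp : 0 < p) (hp1 : p ≤ 1) (hm : 2 < m * p) {M N : BanachC}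
    {f : M.carrier →L[ℂ] N.carrier} (hf : IsCompOfTraceClass (m + 1) M N f) :
    HasOrderRep p f := by
  cases hf with
  | single => norm_num at hm
  | comp n V Z W g h hg hh =>
    obtain ⟨A, B, -, -, -, rfl, -⟩ := trace_factor g hg
    obtain ⟨C, D, hC, hD, hG⟩ := gelf_comp hh B
    obtain ⟨φ, w, c, ⟨K, hφ⟩, hw, hc, hU⟩ := rep_of_gelf (h.comp B) C D hC hD m hG p hp hp1 hm
    refine ⟨fun k => (φ k).comp A, w, c, ⟨K * ‖A‖, fun k => ?_⟩, hw, hc, fun v => hU (A v)⟩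
    refine (ContinuousLinearMap.opNorm_comp_le _ _).trans ?_
    gcongr
    exact hφ k

/-- **Grothendieck.** For a bounded `ℂ`-linear map `f` between complex
Banach spaces, the following are equivalent: (i) `f` has order zero, i.e. for every
`p ∈ (0,1]` it admits a trace-class representation with `∑ ‖λ_n‖^p < ∞`; (ii) `f` is
factorisably trace-class, i.e. for every `n ≥ 2` it is a composition of `n` trace-class
maps through complex Banach spaces. -/
theorem stmt6 (M N : BanachC) (f : M.carrier →L[ℂ] N.carrier) :
    (∀ p : ℝ, 0 < p → p ≤ 1 → HasOrderRep p f) ↔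
      (∀ n : ℕ, 2 ≤ n → IsCompOfTraceClass n M N f) := by
  constructor
  · intro h n hn
    obtain ⟨m, rfl⟩ : ∃ m, n = m + 1 := ⟨n - 1, by omega⟩
    refine comp_of_rep m M N f (h _ (by positivity) ?_)
    rw [div_le_one (by positivity)]
    linarith [(Nat.cast_nonneg m : (0 : ℝ) ≤ m)]
  · intro h p hp hp1
    obtain ⟨m, hm⟩ := exists_nat_gt (2 / p)
    have hm2 : 2 < m * p := (div_lt_iff₀ hp).1 hm
    refine rep_of_comp hp hp1 hm2 (h (m + 1) ?_)
    have : m ≠ 0 := by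
      rintro rfl
      norm_num at hm2
    omega
end

section
/- Let f : M → N be a bounded ℂ-linear map between complex Banach spaces admitting a representation f(x) = Σ_n λ_n f_n(x) g_n, where (f_n) is a bounded sequence of continuous linear functionals on M, (g_n) is a bounded sequence in N, and the scalar sequence (λ_n) is rapidly decreasing, i.e. for every k ∈ ℕ the sequence (n^k λ_n) is bounded. Then there exist a complex Banach space Z and bounded linear maps g : M → Z and h : Z → N with f = h ∘ g, such that both g and h admit representations of the same form with rapidly decreasing coefficient sequences. In particular, a trace-class map of order zero factors as a composition of two trace-class maps of order zero. -/
/-- A bounded `ℂ`-linear map `f` has a representation `f x = ∑ n, c n * φ n x • w n` with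
`(φ n)` a bounded sequence of continuous functionals, `(w n)` a bounded sequence of
vectors, and `(c n)` a rapidly decreasing scalar sequence
(`∀ k, (n ^ k * ‖c n‖)ₙ is bounded`). -/
def HasRapidRep {V W : Type*} [NormedAddCommGroup V] [NormedSpace ℂ V]
    [NormedAddCommGroup W] [NormedSpace ℂ W] (f : V →L[ℂ] W) : Prop :=
  ∃ (φ : ℕ → (V →L[ℂ] ℂ)) (w : ℕ → W) (c : ℕ → ℂ),
    (∃ C : ℝ, ∀ n, ‖φ n‖ ≤ C) ∧ (∃ C : ℝ, ∀ n, ‖w n‖ ≤ C) ∧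
    (∀ k : ℕ, ∃ C : ℝ, ∀ n : ℕ, (n : ℝ) ^ k * ‖c n‖ ≤ C) ∧
    ∀ v : V, HasSum (fun n => (c n * (φ n) v) • w n) (f v)

theorem rapid_summable (c : ℕ → ℂ)
    (hc : ∀ k : ℕ, ∃ C : ℝ, ∀ n : ℕ, (n : ℝ) ^ k * ‖c n‖ ≤ C) : Summable (fun n => ‖c n‖) := by
  obtain ⟨C, hC⟩ := hc 2
  have hs : Summable (fun n : ℕ => C * (1 / (n : ℝ) ^ 2)) :=
    (Real.summable_one_div_nat_pow.mpr one_lt_two).mul_left C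
  rw [← summable_nat_add_iff 1] at hs ⊢
  refine Summable.of_nonneg_of_le (fun n => norm_nonneg _) (fun n => ?_) hs
  have hp : (0 : ℝ) < ((n + 1 : ℕ) : ℝ) ^ 2 := by positivity
  rw [mul_one_div, le_div_iff₀ hp, mul_comm]
  exact hC (n + 1)

theorem rapid_exists {V W : Type*} [NormedAddCommGroup V] [NormedSpace ℂ V]
    [NormedAddCommGroup W] [NormedSpace ℂ W] [CompleteSpace W]
    (φ : ℕ → (V →L[ℂ] ℂ)) (w : ℕ → W) (c : ℕ → ℂ)
    (hφ : ∃ C : ℝ, ∀ n, ‖φ n‖ ≤ C) (hw : ∃ C : ℝ, ∀ n, ‖w n‖ ≤ C)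
    (hc : ∀ k : ℕ, ∃ C : ℝ, ∀ n : ℕ, (n : ℝ) ^ k * ‖c n‖ ≤ C) :
    ∃ g : V →L[ℂ] W, ∀ v : V, HasSum (fun n => (c n * (φ n) v) • w n) (g v) := by
  obtain ⟨A, hA⟩ := hφ
  obtain ⟨B, hB⟩ := hw
  have hA0 : 0 ≤ A := (norm_nonneg _).trans (hA 0)
  have hs : Summable (fun n => c n • (φ n).smulRight (w n)) := by
    refine Summable.of_norm_bounded ((rapid_summable c hc).mul_right (A * B)) (fun n => ?_)
    rw [norm_smul, ContinuousLinearMap.norm_smulRight_apply]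
    exact mul_le_mul_of_nonneg_left
      (mul_le_mul (hA n) (hB n) (norm_nonneg _) hA0) (norm_nonneg _)
  refine ⟨∑' n, c n • (φ n).smulRight (w n), fun v => ?_⟩
  have := hs.hasSum.mapL (ContinuousLinearMap.apply ℂ W v)
  simpa [mul_smul] using this

/-- A bounded `ℂ`-linear map between complex Banach spaces admitting a
trace-class representation with rapidly decreasing coefficient sequence factors as a
composition `f = h ∘ g` through a complex Banach space `Z`, where `g` and `h` again admit
representations with rapidly decreasing coefficients.  In particular, a trace-class map of
order zero factors as a composition of two trace-class maps of order zero. -/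
theorem stmt7 (M N : BanachC) (f : M.carrier →L[ℂ] N.carrier) (hf : HasRapidRep f) :
    ∃ (Z : BanachC) (g : M.carrier →L[ℂ] Z.carrier) (h : Z.carrier →L[ℂ] N.carrier),
      f = h.comp g ∧ HasRapidRep g ∧ HasRapidRep h := by
  obtain ⟨φ, w, c, hφ, hw, hc, hsum⟩ := hf
  let Z : BanachC := ⟨lp (fun _ : ℕ => ℂ) 2⟩
  let e : HilbertBasis ℕ ℂ (lp (fun _ : ℕ => ℂ) 2) := HilbertBasis.ofRepr (LinearIsometryEquiv.refl ℂ _)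
  have he : Orthonormal ℂ e := e.orthonormal
  let a : ℕ → ℂ := fun n => ((√‖c n‖ : ℝ) : ℂ)
  let b : ℕ → ℂ := fun n => c n / a n
  have hna : ∀ n, ‖a n‖ = √‖c n‖ := fun n => by
    simp [a, abs_of_nonneg (Real.sqrt_nonneg _)]
  have hnb : ∀ n, ‖b n‖ = √‖c n‖ := fun n => by
    simp only [b, norm_div, hna, Real.div_sqrt]
  have hab : ∀ n, b n * a n = c n := fun n => by
    by_cases h : c n = 0
    · simp [b, h]
    · refine div_mul_cancel₀ _ ?_
      rw [← norm_ne_zero_iff, hna]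
      exact (Real.sqrt_pos.mpr (norm_pos_iff.mpr h)).ne'
  have hr : ∀ k : ℕ, ∃ C : ℝ, ∀ n : ℕ, (n : ℝ) ^ k * √‖c n‖ ≤ C := fun k => by
    obtain ⟨C, hC⟩ := hc (2 * k)
    refine ⟨√C, fun n => Real.le_sqrt_of_sq_le ?_⟩
    rw [mul_pow, Real.sq_sqrt (norm_nonneg _), ← pow_mul, mul_comm k 2]
    exact hC n
  have hra : ∀ k : ℕ, ∃ C : ℝ, ∀ n : ℕ, (n : ℝ) ^ k * ‖a n‖ ≤ C := by simpa only [hna] using hr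
  have hrb : ∀ k : ℕ, ∃ C : ℝ, ∀ n : ℕ, (n : ℝ) ^ k * ‖b n‖ ≤ C := by simpa only [hnb] using hr
  have hne : ∃ C : ℝ, ∀ n, ‖e n‖ ≤ C := ⟨1, fun n => (he.1 n).le⟩
  have hni : ∃ C : ℝ, ∀ n, ‖innerSL ℂ (e n)‖ ≤ C :=
    ⟨1, fun n => by rw [innerSL_apply_norm]; exact (he.1 n).le⟩
  obtain ⟨g, hg⟩ := rapid_exists φ (fun n => e n) a hφ hne hra
  obtain ⟨h, hh⟩ := rapid_exists (fun n => innerSL ℂ (e n)) w b hni hw hrb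
  refine ⟨Z, g, h, ?_, ⟨φ, fun n => e n, a, hφ, hne, hra, hg⟩,
    ⟨fun n => innerSL ℂ (e n), w, b, hni, hw, hrb, hh⟩⟩
  ext v
  refine (hsum v).unique ?_
  have key : ∀ n, innerSL ℂ (e n) (g v) = a n * φ n v := fun n => by
    have h1 := (hg v).mapL (innerSL ℂ (e n))
    refine h1.unique ?_
    have h2 := hasSum_ite_eq n (a n * φ n v)
    have h4 : (fun m => innerSL ℂ (e n) ((a m * φ m v) • e m)) =
        fun m => if m = n then a n * φ n v else 0 := funext fun m => by
      rw [map_smul, innerSL_apply_apply, orthonormal_iff_ite.mp he n m]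
      by_cases hm : m = n
      · subst hm; simp
      · simp [hm, Ne.symm hm]
    rw [h4]
    exact h2
  have h3 := hh (g v)
  simp only [key, ← mul_assoc, hab] at h3
  exact h3
end

section
/- Let K be a field complete with respect to a nontrivial nonarchimedean absolute value. Then every trace-class map f : V → W between Banach K-spaces factors as a composition f = c ∘ p, where p : V → Z and c : Z → W are trace-class maps for some Banach K-space Z. -/
/-- A bundled ultrametric (nonarchimedean) Banach space over a nonarchimedean normed
field `K`. -/
structure NABanach (K : Type*) [NontriviallyNormedField K] where
  carrier : Type
  [grp : NormedAddCommGroup carrier]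
  [mod : NormedSpace K carrier]
  [cpl : CompleteSpace carrier]
  [ultra : IsUltrametricDist carrier]

attribute [instance] NABanach.grp NABanach.mod NABanach.cpl NABanach.ultra

/-- A bounded `K`-linear map `f` between nonarchimedean Banach `K`-spaces is trace-class
if `f v = ∑ n, c n * φ n v • w n` with `(φ n)` a bounded sequence of continuous
functionals, `(w n)` a bounded sequence of vectors, and `(c n)` a null sequence in `K`. -/
def NATraceClass {K : Type*} [NontriviallyNormedField K] {V W : Type*}
    [NormedAddCommGroup V] [NormedSpace K V] [NormedAddCommGroup W] [NormedSpace K W]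
    (f : V →L[K] W) : Prop :=
  ∃ (φ : ℕ → (V →L[K] K)) (w : ℕ → W) (c : ℕ → K),
    (∃ C : ℝ, ∀ n, ‖φ n‖ ≤ C) ∧ (∃ C : ℝ, ∀ n, ‖w n‖ ≤ C) ∧
    Filter.Tendsto c Filter.atTop (nhds 0) ∧
    ∀ v : V, HasSum (fun n => (c n * (φ n) v) • w n) (f v)

open Filter Topology in
theorem na_mk {K : Type*} [NontriviallyNormedField K] {V W : Type*}
    [NormedAddCommGroup V] [NormedSpace K V] [NormedAddCommGroup W] [NormedSpace K W]
    [CompleteSpace W] [IsUltrametricDist W]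
    (φ : ℕ → (V →L[K] K)) (w : ℕ → W) (c : ℕ → K)
    (hφ : ∃ C : ℝ, ∀ n, ‖φ n‖ ≤ C) (hw : ∃ C : ℝ, ∀ n, ‖w n‖ ≤ C)
    (hc : Tendsto c atTop (𝓝 0)) :
    ∃ g : V →L[K] W, ∀ v : V, HasSum (fun n => (c n * (φ n) v) • w n) (g v) := by
  obtain ⟨A, hA⟩ := hφ
  obtain ⟨B, hB⟩ := hw
  have hA0 : 0 ≤ A := (norm_nonneg _).trans (hA 0)
  have hB0 : 0 ≤ B := (norm_nonneg _).trans (hB 0)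
  have key : ∀ v n, ‖(c n * (φ n) v) • w n‖ ≤ ‖c n‖ * (A * ‖v‖ * B) := by
    intro v n
    rw [norm_smul, norm_mul, mul_assoc]
    have h1 : ‖φ n v‖ ≤ A * ‖v‖ := (φ n).le_of_opNorm_le (hA n) v
    have h2 := hB n
    gcongr
  have hs : ∀ v, Summable (fun n => (c n * (φ n) v) • w n) := by
    intro v
    apply NonarchimedeanAddGroup.summable_of_tendsto_cofinite_zero
    rw [Nat.cofinite_eq_atTop]
    apply squeeze_zero_norm (key v)
    have := hc.norm.mul_const (A * ‖v‖ * B)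
    simpa using this
  obtain ⟨C, hC⟩ := hc.norm.bddAbove_range
  have hC' : ∀ n, ‖c n‖ ≤ C := fun n => hC ⟨n, rfl⟩
  have hC0 : 0 ≤ C := (norm_nonneg _).trans (hC' 0)
  refine ⟨LinearMap.mkContinuous
    { toFun := fun v => ∑' n, (c n * (φ n) v) • w n
      map_add' := ?_
      map_smul' := ?_ } (C * A * B) ?_, fun v => (hs v).hasSum⟩
  · intro x y
    rw [← (hs x).tsum_add (hs y)]
    congr 1; ext n
    rw [map_add, mul_add, add_smul]
  · intro k x
    simp only [RingHom.id_apply]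
    rw [← (hs x).tsum_const_smul k]
    congr 1; ext n
    rw [map_smul, smul_smul, smul_eq_mul, mul_left_comm]
  · intro v
    apply IsUltrametricDist.norm_tsum_le_of_forall_le_of_nonneg
    · positivity
    · intro n
      refine (key v n).trans ?_
      have := hC' n
      calc ‖c n‖ * (A * ‖v‖ * B) ≤ C * (A * ‖v‖ * B) := by gcongr
        _ = _ := by ring

open Filter Topology in
theorem na_split {K : Type*} [NontriviallyNormedField K] (c : ℕ → K)
    (hc : Tendsto c atTop (𝓝 0)) :
    ∃ a b : ℕ → K, Tendsto a atTop (𝓝 0) ∧ Tendsto b atTop (𝓝 0) ∧ ∀ n, c n = b n * a n := by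
  obtain ⟨y, hy⟩ := NormedField.exists_one_lt_norm K
  have h : ∀ x : K, ∃ a b : K, ‖a‖ ≤ ‖y‖ * √‖x‖ ∧ ‖b‖ ≤ ‖y‖ * √‖x‖ ∧ x = b * a := by
    intro x
    by_cases hx : x = 0
    · exact ⟨0, 0, by simp [hx], by simp [hx], by simp [hx]⟩
    have hs : 0 < √‖x‖ := Real.sqrt_pos.2 (norm_pos_iff.2 hx)
    obtain ⟨n, h1, h2⟩ := exists_mem_Ioc_zpow hs hy
    have hy0 : y ≠ 0 := norm_pos_iff.1 (by linarith)
    have hp : 0 < ‖y‖ ^ (n+1) := hs.trans_le h2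
    refine ⟨x / y^(n+1), y^(n+1), ?_, ?_, ?_⟩
    · rw [norm_div, norm_zpow, div_le_iff₀ hp]
      have := Real.mul_self_sqrt (norm_nonneg x)
      calc ‖x‖ = 1 * √‖x‖ * √‖x‖ := by rw [one_mul, this]
        _ ≤ _ := by gcongr
    · rw [norm_zpow, zpow_add_one₀ (by linarith), mul_comm]
      gcongr
    · rw [mul_div_cancel₀]
      exact zpow_ne_zero _ hy0
  choose a b h1 h2 h3 using h
  have ht : Tendsto (fun n => ‖y‖ * √‖c n‖) atTop (𝓝 0) := by
    have := ((Real.continuous_sqrt.tendsto _).comp hc.norm).const_mul ‖y‖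
    simpa using this
  exact ⟨fun n => a (c n), fun n => b (c n), squeeze_zero_norm (fun n => h1 _) ht,
    squeeze_zero_norm (fun n => h2 _) ht, fun n => h3 _⟩

theorem na_bcf_ultra {L : Type*} [NormedAddCommGroup L] [IsUltrametricDist L] :
    IsUltrametricDist (BoundedContinuousFunction ℕ L) := by
  constructor
  intro x y z
  rw [BoundedContinuousFunction.dist_le (le_max_of_le_left dist_nonneg)]
  intro n
  exact (dist_triangle_max (x n) (y n) (z n)).trans
    (max_le_max (BoundedContinuousFunction.dist_coe_le_dist n)
      (BoundedContinuousFunction.dist_coe_le_dist n))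

/-- Over a field `K` complete with respect to a nontrivial nonarchimedean
absolute value, every trace-class map `f : V → W` of Banach `K`-spaces factors as
`f = c ∘ p` with `p : V → Z` and `c : Z → W` trace-class, for some Banach `K`-space `Z`. -/
theorem stmt8 {K : Type*} [NontriviallyNormedField K] [CompleteSpace K]
    [IsUltrametricDist K] (V W : NABanach K) (f : V.carrier →L[K] W.carrier)
    (hf : NATraceClass f) :
    ∃ (Z : NABanach K) (p : V.carrier →L[K] Z.carrier) (c : Z.carrier →L[K] W.carrier),
      f = c.comp p ∧ NATraceClass p ∧ NATraceClass c := by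
  by_cases hW : ∀ w : W.carrier, w = 0
  · refine ⟨W, f, 0, ?_, hf, ?_⟩
    · ext v
      rw [hW (f v)]; simp
    · exact ⟨0, 0, 0, ⟨0, by simp⟩, ⟨0, by simp⟩, tendsto_const_nhds, fun v => by
        simpa using (hasSum_zero : HasSum (fun _ : ℕ => (0 : W.carrier)) 0)⟩
  push Not at hW
  obtain ⟨w0, hw0⟩ := hW
  obtain ⟨φ, w, c, hφ, hw, hc, hsum⟩ := hf
  obtain ⟨a, b, ha, hb, hab⟩ := na_split c hc
  let L : Submodule K W.carrier := Submodule.span K {w0}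
  let e : K ≃L[K] L := ContinuousLinearEquiv.toSpanNonzeroSingleton K w0 hw0
  haveI : CompleteSpace L := FiniteDimensional.complete K L
  haveI : IsUltrametricDist L := ⟨fun x y z => dist_triangle_max (x : W.carrier) y z⟩
  haveI : IsUltrametricDist (BoundedContinuousFunction ℕ L) := na_bcf_ultra
  let ev : ℕ → (BoundedContinuousFunction ℕ L →L[K] L) := fun n =>
    BoundedContinuousFunction.evalCLM K n
  let ψ : ℕ → (BoundedContinuousFunction ℕ L →L[K] K) := fun n =>
    (e.symm : L →L[K] K).comp (ev n)
  have hψ : ∃ C : ℝ, ∀ n, ‖ψ n‖ ≤ C := by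
    refine ⟨‖(e.symm : L →L[K] K)‖, fun n => ?_⟩
    refine ContinuousLinearMap.opNorm_le_bound _ (norm_nonneg _) fun z => ?_
    refine ((e.symm : L →L[K] K).le_opNorm _).trans ?_
    gcongr
    exact z.norm_coe_le_norm n
  have hbd : ∀ n m : ℕ, ‖(Pi.single n (e 1) : ℕ → L) m‖ ≤ ‖e 1‖ := by
    intro n m
    by_cases h : m = n
    · subst h; simp
    · simp [Pi.single_eq_of_ne h]
  let s : ℕ → BoundedContinuousFunction ℕ L := fun n =>
    BoundedContinuousFunction.ofNormedAddCommGroup (Pi.single n (e 1) : ℕ → L)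
      continuous_of_discreteTopology ‖e 1‖ (hbd n)
  have hs : ∃ C : ℝ, ∀ n, ‖s n‖ ≤ C :=
    ⟨‖e 1‖, fun n => BoundedContinuousFunction.norm_ofNormedAddCommGroup_le _ (norm_nonneg _) _⟩
  obtain ⟨p, hp⟩ := na_mk φ s a hφ hs ha
  obtain ⟨q, hq⟩ := na_mk ψ w b hψ hw hb
  refine ⟨⟨BoundedContinuousFunction ℕ L⟩, p, q, ?_, ⟨φ, s, a, hφ, hs, ha, hp⟩,
    ⟨ψ, w, b, hψ, hw, hb, hq⟩⟩
  have hpn : ∀ v n, ψ n (p v) = a n * φ n v := by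
    intro v n
    have h1 := (ψ n).hasSum (hp v)
    have hss : ∀ m, ψ n (s m) = if m = n then 1 else 0 := by
      intro m
      change e.symm ((Pi.single m (e 1) : ℕ → L) n) = _
      split_ifs with h
      · subst h; simp
      · rw [Pi.single_eq_of_ne (Ne.symm h)]; simp
    have h2 := hasSum_single (f := fun m => ψ n ((a m * φ m v) • s m)) n (by
      intro m hm
      simp [hss, hm])
    rw [h1.unique h2]
    simp [hss]
  ext v
  refine (hsum v).unique ?_
  have := hq (p v)
  simp only [hpn] at this
  have h2 : (fun n => (c n * φ n v) • w n) = fun n => (b n * (a n * φ n v)) • w n := by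
    ext n
    rw [hab, mul_assoc]
  rw [h2]
  exact this
end

section
/- Let C and D be symmetric monoidal closed categories and F : C → D a strong symmetric monoidal functor. If f : M → N is a trace-class morphism in C, then F(f) : F(M) → F(N) is a trace-class morphism in D. -/
open CategoryTheory MonoidalCategory MonoidalClosed

/-- The dual `M^∨ = [M, 𝟙]` of an object in a monoidal closed category. -/
noncomputable def dualObj {C : Type*} [Category C] [MonoidalCategory C] [MonoidalClosed C]
    (M : C) : C :=
  (ihom M).obj (𝟙_ C)

/-- A morphism `f : M ⟶ N` in a symmetric monoidal closed category is trace-class if there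
is `g : 𝟙 ⟶ M^∨ ⊗ N` such that `f` equals the canonical composite
`M ≅ 𝟙 ⊗ M ⟶ (M^∨ ⊗ N) ⊗ M ≅ (M^∨ ⊗ M) ⊗ N ⟶ 𝟙 ⊗ N ≅ N`
built from the unitors, associator, braiding, `g` and the evaluation
`M^∨ ⊗ M ⟶ 𝟙` of the closed structure. -/
def IsTraceClassHom {C : Type*} [Category C] [MonoidalCategory C] [SymmetricCategory C]
    [MonoidalClosed C] {M N : C} (f : M ⟶ N) : Prop :=
  ∃ g : 𝟙_ C ⟶ dualObj M ⊗ N,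
    f = (λ_ M).inv ≫ (g ▷ M) ≫ (α_ (dualObj M) N M).hom ≫
      (dualObj M ◁ (β_ N M).hom) ≫ (α_ (dualObj M) M N).inv ≫
      (((β_ (dualObj M) M).hom ≫ (ihom.ev M).app (𝟙_ C)) ▷ N) ≫ (λ_ N).hom

theorem traceComp_naturality {C : Type*} [Category C] [MonoidalCategory C]
    [SymmetricCategory C] {M N X Y : C} (c : X ⟶ Y)
    (e : M ⊗ Y ⟶ 𝟙_ C) (g : 𝟙_ C ⟶ X ⊗ N) :
    (λ_ M).inv ≫ (g ▷ M) ≫ (α_ X N M).hom ≫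
      (X ◁ (β_ N M).hom) ≫ (α_ X M N).inv ≫
      (((β_ X M).hom ≫ M ◁ c ≫ e) ▷ N) ≫ (λ_ N).hom =
    (λ_ M).inv ≫ ((g ≫ c ▷ N) ▷ M) ≫ (α_ Y N M).hom ≫
      (Y ◁ (β_ N M).hom) ≫ (α_ Y M N).inv ≫
      (((β_ Y M).hom ≫ e) ▷ N) ≫ (λ_ N).hom := by
  rw [← BraidedCategory.braiding_naturality_left_assoc]
  simp only [comp_whiskerRight, Category.assoc, associator_naturality_left_assoc,
    ← whisker_exchange_assoc, associator_inv_naturality_left_assoc]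

/-- A morphism factoring through any pairing `e : M ⊗ X ⟶ 𝟙` is trace-class. -/
theorem isTraceClassHom_of_pairing {C : Type*} [Category C] [MonoidalCategory C]
    [SymmetricCategory C] [MonoidalClosed C] {M N X : C} (f : M ⟶ N)
    (e : M ⊗ X ⟶ 𝟙_ C) (g : 𝟙_ C ⟶ X ⊗ N)
    (h : f = (λ_ M).inv ≫ (g ▷ M) ≫ (α_ X N M).hom ≫
      (X ◁ (β_ N M).hom) ≫ (α_ X M N).inv ≫
      (((β_ X M).hom ≫ e) ▷ N) ≫ (λ_ N).hom) : IsTraceClassHom f := by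
  let c : X ⟶ dualObj M := curry e
  let ev : M ⊗ dualObj M ⟶ 𝟙_ C := (ihom.ev M).app (𝟙_ C)
  have hc : M ◁ c ≫ ev = e := whiskerLeft_curry_ihom_ev_app M (𝟙_ C) e
  refine ⟨g ≫ c ▷ N, ?_⟩
  rw [h, ← hc]
  exact traceComp_naturality c ev g

theorem map_traceComp {C D : Type*} [Category C] [Category D]
    [MonoidalCategory C] [MonoidalCategory D]
    [SymmetricCategory C] [SymmetricCategory D]
    (F : C ⥤ D) [F.Braided] {M N X : C} (e : M ⊗ X ⟶ 𝟙_ C) (g : 𝟙_ C ⟶ X ⊗ N) :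
    F.map ((λ_ M).inv ≫ (g ▷ M) ≫ (α_ X N M).hom ≫
      (X ◁ (β_ N M).hom) ≫ (α_ X M N).inv ≫
      (((β_ X M).hom ≫ e) ▷ N) ≫ (λ_ N).hom) =
    (λ_ (F.obj M)).inv ≫
      ((Functor.LaxMonoidal.ε F ≫ F.map g ≫ Functor.OplaxMonoidal.δ F _ _) ▷ F.obj M) ≫
      (α_ (F.obj X) (F.obj N) (F.obj M)).hom ≫
      (F.obj X ◁ (β_ (F.obj N) (F.obj M)).hom) ≫ (α_ (F.obj X) (F.obj M) (F.obj N)).inv ≫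
      (((β_ (F.obj X) (F.obj M)).hom ≫
        Functor.LaxMonoidal.μ F _ _ ≫ F.map e ≫ Functor.OplaxMonoidal.η F) ▷ F.obj N) ≫
      (λ_ (F.obj N)).hom := by
  simp only [Functor.map_comp, Functor.Monoidal.map_leftUnitor,
    Functor.Monoidal.map_leftUnitor_inv,
    Functor.Monoidal.map_whiskerRight, Functor.Monoidal.map_whiskerLeft,
    Functor.Monoidal.map_associator, Functor.Monoidal.map_associator_inv, Functor.map_braiding,
    Category.assoc, Functor.Monoidal.μ_δ_assoc, comp_whiskerRight, whiskerLeft_comp,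
    Functor.Monoidal.whiskerLeft_μ_δ_assoc, Functor.Monoidal.whiskerRight_μ_δ_assoc]

/-- A strong symmetric monoidal functor `F : C ⥤ D` between symmetric
monoidal closed categories sends trace-class morphisms to trace-class morphisms. -/
theorem stmt9 {C D : Type*} [Category C] [Category D]
    [MonoidalCategory C] [MonoidalCategory D]
    [SymmetricCategory C] [SymmetricCategory D]
    [MonoidalClosed C] [MonoidalClosed D]
    (F : C ⥤ D) [F.Braided]
    {M N : C} (f : M ⟶ N) (hf : IsTraceClassHom f) :
    IsTraceClassHom (F.map f) := by
  obtain ⟨g, hg⟩ := hf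
  let ev : M ⊗ dualObj M ⟶ 𝟙_ C := (ihom.ev M).app (𝟙_ C)
  exact isTraceClassHom_of_pairing (X := F.obj (dualObj M)) (F.map f)
    (Functor.LaxMonoidal.μ F _ _ ≫ F.map ev ≫ Functor.OplaxMonoidal.η F)
    (Functor.LaxMonoidal.ε F ≫ F.map g ≫ Functor.OplaxMonoidal.δ F _ _)
    ((congrArg F.map hg).trans (map_traceComp F ev g))
end

section
/- Let q : Y → Z be a surjective additive map of seminormed abelian groups which is a strong epimorphism, i.e. for every z ∈ Z there exists y ∈ Y with q(y) = z and ‖y‖ = ‖z‖. Then for every y ∈ Y with ‖q(y)‖ = 0 there exists k ∈ ker(q) with ‖y − k‖ = 0. Consequently, passing to the separated quotients (quotient by the subgroup of elements of seminorm zero), the induced sequence ker(q)/{‖·‖=0} → Y/{‖·‖=0} → Z/{‖·‖=0} is exact in the middle; that is, the separation functor sends strong short exact sequences of seminormed abelian groups to short exact sequences of normed abelian groups. -/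
/-- The subgroup of elements of seminorm zero in a seminormed abelian group; quotienting
by it gives the separated quotient with its induced norm. -/
def normNullSubgroup (M : Type*) [SeminormedAddCommGroup M] : AddSubgroup M where
  carrier := {x : M | ‖x‖ = 0}
  zero_mem' := by simp
  add_mem' := by
    intro a b ha hb
    simp only [Set.mem_setOf_eq] at *
    exact le_antisymm ((norm_add_le a b).trans (by rw [ha, hb]; norm_num)) (norm_nonneg _)
  neg_mem' := by
    intro a ha
    simp only [Set.mem_setOf_eq, norm_neg] at *
    exact ha

theorem null_le_comap_subtype {Y Z : Type*} [SeminormedAddCommGroup Y]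
    [SeminormedAddCommGroup Z] (q : Y →+ Z) :
    normNullSubgroup ↥q.ker ≤ (normNullSubgroup Y).comap q.ker.subtype := by
  intro k hk
  exact hk

theorem null_le_comap_of_bound {Y Z : Type*} [SeminormedAddCommGroup Y]
    [SeminormedAddCommGroup Z] (q : Y →+ Z)
    (hbdd : ∃ C : ℝ, ∀ y : Y, ‖q y‖ ≤ C * ‖y‖) :
    normNullSubgroup Y ≤ (normNullSubgroup Z).comap q := by
  intro y hy
  obtain ⟨C, hC⟩ := hbdd
  have hy0 : ‖y‖ = 0 := hy
  have h1 : ‖q y‖ ≤ 0 := by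
    have h2 := hC y
    rw [hy0, mul_zero] at h2
    exact h2
  show ‖q y‖ = 0
  exact le_antisymm h1 (norm_nonneg _)

/-- Let `q : Y → Z` be a (bounded) additive map of seminormed abelian
groups that is a strong epimorphism: every `z ∈ Z` has a preimage of the same seminorm.
Then every `y` with `‖q y‖ = 0` differs from an element of `ker q` by an element of
seminorm zero; consequently the induced sequence
`ker q / {‖·‖ = 0} → Y / {‖·‖ = 0} → Z / {‖·‖ = 0}` of separated quotients is exact in the
middle. -/
theorem stmt10 {Y Z : Type*} [SeminormedAddCommGroup Y] [SeminormedAddCommGroup Z]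
    (q : Y →+ Z) (hbdd : ∃ C : ℝ, ∀ y : Y, ‖q y‖ ≤ C * ‖y‖)
    (hstrong : ∀ z : Z, ∃ y : Y, q y = z ∧ ‖y‖ = ‖z‖) :
    (∀ y : Y, ‖q y‖ = 0 → ∃ k : Y, q k = 0 ∧ ‖y - k‖ = 0) ∧
    Function.Exact
      (⇑(QuotientAddGroup.map (normNullSubgroup ↥q.ker) (normNullSubgroup Y)
        q.ker.subtype (null_le_comap_subtype q)))
      (⇑(QuotientAddGroup.map (normNullSubgroup Y) (normNullSubgroup Z) q
        (null_le_comap_of_bound q hbdd))) := by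
  have key : ∀ y : Y, ‖q y‖ = 0 → ∃ k : Y, q k = 0 ∧ ‖y - k‖ = 0 := by
    intro y hy
    obtain ⟨u, hu, hn⟩ := hstrong (q y)
    refine ⟨y - u, by rw [map_sub, hu, sub_self], ?_⟩
    rw [sub_sub_cancel, hn, hy]
  refine ⟨key, ?_⟩
  intro x
  obtain ⟨y, rfl⟩ := QuotientAddGroup.mk_surjective x
  constructor
  · intro h
    have hy : ‖q y‖ = 0 := (QuotientAddGroup.eq_zero_iff (N := normNullSubgroup Z) (q y)).1 h
    obtain ⟨k, hk, hn⟩ := key y hy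
    refine ⟨QuotientAddGroup.mk ⟨k, hk⟩, ?_⟩
    refine (QuotientAddGroup.eq (s := normNullSubgroup Y) (a := k) (b := y)).2 ?_
    rw [neg_add_eq_sub]
    exact hn
  · rintro ⟨w, hw⟩
    obtain ⟨k, rfl⟩ := QuotientAddGroup.mk_surjective w
    rw [← hw]
    refine (QuotientAddGroup.eq_zero_iff (N := normNullSubgroup Z) (q (k : Y))).2 ?_
    have hk : q (k : Y) = 0 := k.2
    rw [hk]
    exact (normNullSubgroup Z).zero_mem
end

section
/- Let R be a commutative ring, π ∈ R, and ρ ∈ (0,1). Assume R is π-torsion free, and let M and N be π-torsion-free R-modules equipped with π-adic norms relative to ρ; assume also that M ⊗_R N is π-torsion free. Define the tensor seminorm σ on M ⊗_R N by σ(v) = inf{ max_{1≤i≤k} ‖x_i‖·‖y_i‖ : v = Σ_{i=1}^k x_i ⊗ y_i }, the infimum taken over all finite representations of v. Then σ coincides with the π-adic seminorm of M ⊗_R N: for every v ∈ M ⊗_R N and every l ≥ 0, σ(v) ≤ ρ^l if and only if v ∈ π^l (M ⊗_R N); moreover σ(π·v) = ρ·σ(v) for all v. -/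
/-- A `π`-adic norm relative to `ρ ∈ (0,1)` on an `R`-module `M`: a function `ν : M → ℝ`
with `ν m = ρ ^ l` whenever `m ∈ π ^ l • M` and `m ∉ π ^ (l+1) • M`, with `ν m = 0` iff
`m = 0`; in particular `⋂ l, π ^ l • M = 0`. -/
def IsPiAdicNorm {R : Type*} [CommRing R] (π : R) (ρ : ℝ)
    {M : Type*} [AddCommGroup M] [Module R M] (ν : M → ℝ) : Prop :=
  (∀ (m : M) (l : ℕ), (∃ x : M, m = π ^ l • x) → ¬(∃ x : M, m = π ^ (l + 1) • x) →
    ν m = ρ ^ l) ∧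
  (∀ m : M, ν m = 0 ↔ m = 0) ∧
  (∀ m : M, (∀ l : ℕ, ∃ x : M, m = π ^ l • x) → m = 0)

/-- The tensor (projective) seminorm on `M ⊗[R] N`:
`σ v = inf { maxᵢ ‖xᵢ‖ * ‖yᵢ‖ : v = ∑ᵢ xᵢ ⊗ yᵢ }`, the infimum over all finite
representations of `v`. -/
noncomputable def tensorSeminorm {R M N : Type*} [CommRing R] [AddCommGroup M] [Module R M]
    [AddCommGroup N] [Module R N] (νM : M → ℝ) (νN : N → ℝ)
    (v : TensorProduct R M N) : ℝ :=
  sInf {t : ℝ | ∃ (k : ℕ) (x : Fin (k + 1) → M) (y : Fin (k + 1) → N),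
    v = ∑ i, x i ⊗ₜ[R] y i ∧
    t = Finset.univ.sup' Finset.univ_nonempty (fun i => νM (x i) * νN (y i))}

open scoped TensorProduct

lemma exists_max_pow {R : Type*} [CommRing R] (π : R) {M : Type*} [AddCommGroup M] [Module R M]
    (m : M) : (∀ l : ℕ, ∃ x : M, m = π ^ l • x) ∨
      ∃ l : ℕ, (∃ x : M, m = π ^ l • x) ∧ ¬ ∃ x : M, m = π ^ (l + 1) • x := by
  by_cases h : ∀ l : ℕ, ∃ x : M, m = π ^ l • x
  · exact Or.inl h
  · right
    by_contra hc
    apply h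
    intro l
    induction l with
    | zero => exact ⟨m, by simp⟩
    | succ l ih =>
      by_contra h2
      exact hc ⟨l, ih, h2⟩

lemma pow_mem_mono {R : Type*} [CommRing R] (π : R) {M : Type*} [AddCommGroup M] [Module R M]
    {m : M} {k l : ℕ} (hkl : l ≤ k) (h : ∃ x : M, m = π ^ k • x) : ∃ x : M, m = π ^ l • x := by
  obtain ⟨x, rfl⟩ := h
  refine ⟨π ^ (k - l) • x, ?_⟩
  rw [smul_smul, ← pow_add, Nat.add_sub_cancel' hkl]

lemma IsPiAdicNorm.cases {R : Type*} [CommRing R] {π : R} {ρ : ℝ} {M : Type*} [AddCommGroup M]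
    [Module R M] {ν : M → ℝ} (h : IsPiAdicNorm π ρ ν) (m : M) :
    (m = 0 ∧ ν m = 0) ∨ ∃ l : ℕ, (∃ x : M, m = π ^ l • x) ∧
      (¬ ∃ x : M, m = π ^ (l + 1) • x) ∧ ν m = ρ ^ l := by
  rcases exists_max_pow π m with h1 | ⟨l, h1, h2⟩
  · have := h.2.2 m h1
    exact Or.inl ⟨this, (h.2.1 m).2 this⟩
  · exact Or.inr ⟨l, h1, h2, h.1 m l h1 h2⟩

lemma IsPiAdicNorm.nonneg {R : Type*} [CommRing R] {π : R} {ρ : ℝ} (hρ0 : 0 < ρ)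
    {M : Type*} [AddCommGroup M]
    [Module R M] {ν : M → ℝ} (h : IsPiAdicNorm π ρ ν) (m : M) : 0 ≤ ν m := by
  rcases h.cases m with ⟨_, h⟩ | ⟨l, _, _, h⟩ <;> rw [h]
  positivity

lemma IsPiAdicNorm.le_pow {R : Type*} [CommRing R] {π : R} {ρ : ℝ} (hρ0 : 0 < ρ) (hρ1 : ρ < 1)
    {M : Type*} [AddCommGroup M]
    [Module R M] {ν : M → ℝ} (h : IsPiAdicNorm π ρ ν) (x : M) (l : ℕ) : ν (π ^ l • x) ≤ ρ ^ l := by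
  rcases h.cases (π ^ l • x) with ⟨_, h⟩ | ⟨k, _, h2, h⟩ <;> rw [h]
  · positivity
  · apply pow_le_pow_of_le_one hρ0.le hρ1.le
    by_contra hk
    exact h2 (pow_mem_mono π (by omega : k + 1 ≤ l) ⟨x, rfl⟩)

section
variable {R M N : Type*} [CommRing R] [AddCommGroup M] [Module R M]
    [AddCommGroup N] [Module R N] {π : R} {ρ : ℝ} {νM : M → ℝ} {νN : N → ℝ}

lemma tmul_mem (hρ0 : 0 < ρ) (hρ1 : ρ < 1)
    (hνM : IsPiAdicNorm π ρ νM) (hνN : IsPiAdicNorm π ρ νN) (x : M) (y : N) (l : ℕ)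
    (h : νM x * νN y < ρ ^ l) : ∃ w : M ⊗[R] N, x ⊗ₜ[R] y = π ^ (l + 1) • w := by
  rcases hνM.cases x with ⟨rfl, _⟩ | ⟨a, ⟨x', hx'⟩, _, ha⟩
  · exact ⟨0, by simp⟩
  rcases hνN.cases y with ⟨rfl, _⟩ | ⟨b, ⟨y', hy'⟩, _, hb⟩
  · exact ⟨0, by simp⟩
  rw [ha, hb, ← pow_add] at h
  have hlt : l < a + b := by
    by_contra hc
    exact absurd (pow_le_pow_of_le_one hρ0.le hρ1.le (not_lt.1 hc)) (not_le.2 h)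
  apply pow_mem_mono π (by omega : l + 1 ≤ a + b)
  refine ⟨x' ⊗ₜ y', ?_⟩
  rw [hx', hy', TensorProduct.smul_tmul_smul, pow_add]

lemma tensor_sum_mem (hρ0 : 0 < ρ) (hρ1 : ρ < 1)
    (hνM : IsPiAdicNorm π ρ νM) (hνN : IsPiAdicNorm π ρ νN) (k : ℕ)
    (x : Fin (k + 1) → M) (y : Fin (k + 1) → N) (l : ℕ)
    (h : Finset.univ.sup' Finset.univ_nonempty (fun i => νM (x i) * νN (y i)) < ρ ^ l) :
    ∃ w : M ⊗[R] N, ∑ i, x i ⊗ₜ[R] y i = π ^ (l + 1) • w := by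
  have h1 : ∀ i, ∃ w : M ⊗[R] N, x i ⊗ₜ[R] y i = π ^ (l + 1) • w := fun i =>
    tmul_mem hρ0 hρ1 hνM hνN _ _ l ((Finset.sup'_lt_iff _).1 h i (Finset.mem_univ i))
  choose w hw using h1
  exact ⟨∑ i, w i, by rw [Finset.smul_sum]; exact Finset.sum_congr rfl fun i _ => hw i⟩

lemma exists_rep (v : M ⊗[R] N) : ∃ (k : ℕ) (x : Fin (k + 1) → M) (y : Fin (k + 1) → N),
    v = ∑ i, x i ⊗ₜ[R] y i := by
  induction v using TensorProduct.induction_on with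
  | zero => exact ⟨0, 0, 0, by simp⟩
  | tmul a b => exact ⟨0, fun _ => a, fun _ => b, by simp⟩
  | add v w hv hw =>
    obtain ⟨k, x, y, rfl⟩ := hv
    obtain ⟨k', x', y', rfl⟩ := hw
    refine ⟨k + 1 + k', Fin.append (m := k + 1) (n := k' + 1) x x',
      Fin.append (m := k + 1) (n := k' + 1) y y', ?_⟩
    refine Eq.trans ?_ (Fin.sum_univ_add (a := k + 1) (b := k' + 1) _).symm
    simp

lemma mem_nonneg (hρ0 : 0 < ρ)
    (hνM : IsPiAdicNorm π ρ νM) (hνN : IsPiAdicNorm π ρ νN) {k : ℕ}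
    (x : Fin (k + 1) → M) (y : Fin (k + 1) → N) :
    0 ≤ Finset.univ.sup' Finset.univ_nonempty (fun i => νM (x i) * νN (y i)) :=
  (mul_nonneg (hνM.nonneg hρ0 (x 0)) (hνN.nonneg hρ0 (y 0))).trans
    (Finset.le_sup' (fun i => νM (x i) * νN (y i)) (Finset.mem_univ 0))

lemma seminorm_nonneg (hρ0 : 0 < ρ)
    (hνM : IsPiAdicNorm π ρ νM) (hνN : IsPiAdicNorm π ρ νN) (v : M ⊗[R] N) :
    0 ≤ tensorSeminorm νM νN v := by
  apply Real.sInf_nonneg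
  rintro t ⟨k, x, y, -, rfl⟩
  exact mem_nonneg hρ0 hνM hνN x y

lemma seminorm_le (hρ0 : 0 < ρ) (hρ1 : ρ < 1)
    (hνM : IsPiAdicNorm π ρ νM) (hνN : IsPiAdicNorm π ρ νN) (w : M ⊗[R] N) (l : ℕ) :
    tensorSeminorm νM νN (π ^ l • w) ≤ ρ ^ l := by
  obtain ⟨k, x, y, rfl⟩ := exists_rep w
  unfold tensorSeminorm
  refine le_trans (csInf_le (a := Finset.univ.sup' Finset.univ_nonempty
    (fun i => νM (π ^ l • x i) * νN (y i))) ⟨0, ?_⟩ ⟨k, fun i => π ^ l • x i, y, ?_, rfl⟩) ?_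
  · rintro t ⟨k, x, y, -, rfl⟩
    exact mem_nonneg hρ0 hνM hνN x y
  · rw [Finset.smul_sum]
    rfl
  · apply Finset.sup'_le
    intro i _
    have h1 := hνM.le_pow hρ0 hρ1 (x i) l
    have h2 := hνN.le_pow hρ0 hρ1 (y i) 0
    simp only [pow_zero, one_smul] at h2
    calc _ ≤ ρ ^ l * 1 := mul_le_mul h1 h2 (hνN.nonneg hρ0 _) (by positivity)
      _ = _ := mul_one _

lemma le_seminorm (hρ0 : 0 < ρ) (hρ1 : ρ < 1)
    (hνM : IsPiAdicNorm π ρ νM) (hνN : IsPiAdicNorm π ρ νN) (v : M ⊗[R] N) (l : ℕ)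
    (h : ¬ ∃ w : M ⊗[R] N, v = π ^ (l + 1) • w) :
    ρ ^ l ≤ tensorSeminorm νM νN v := by
  apply le_csInf
  · obtain ⟨k, x, y, hv⟩ := exists_rep v
    exact ⟨_, k, x, y, hv, rfl⟩
  · rintro t ⟨k, x, y, hv, rfl⟩
    by_contra hc
    apply h
    rw [hv]
    exact tensor_sum_mem hρ0 hρ1 hνM hνN k x y l (not_le.1 hc)

lemma seminorm_eq_zero (hρ0 : 0 < ρ) (hρ1 : ρ < 1)
    (hνM : IsPiAdicNorm π ρ νM) (hνN : IsPiAdicNorm π ρ νN) (v : M ⊗[R] N)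
    (h : ∀ l : ℕ, ∃ w : M ⊗[R] N, v = π ^ l • w) :
    tensorSeminorm νM νN v = 0 := by
  refine le_antisymm ?_ (seminorm_nonneg hρ0 hνM hνN v)
  refine ge_of_tendsto' (tendsto_pow_atTop_nhds_zero_of_lt_one hρ0.le hρ1) fun l => ?_
  obtain ⟨w, rfl⟩ := h l
  exact seminorm_le hρ0 hρ1 hνM hνN w l

end

/-- Let `R` be `π`-torsion free, `M` and `N` `π`-torsion-free
`R`-modules with `π`-adic norms, such that `M ⊗[R] N` is `π`-torsion free.  Then the
tensor seminorm on `M ⊗[R] N` coincides with the `π`-adic seminorm: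
`σ v ≤ ρ ^ l ↔ v ∈ π ^ l • (M ⊗[R] N)` for all `v, l`, and moreover
`σ (π • v) = ρ * σ v`. -/
theorem stmt11 {R M N : Type*} [CommRing R] [AddCommGroup M] [Module R M]
    [AddCommGroup N] [Module R N] (π : R) (ρ : ℝ) (hρ0 : 0 < ρ) (hρ1 : ρ < 1)
    (hR : ∀ r : R, π * r = 0 → r = 0)
    (hM : ∀ m : M, π • m = 0 → m = 0) (hN : ∀ n : N, π • n = 0 → n = 0)
    (hT : ∀ v : TensorProduct R M N, π • v = 0 → v = 0)
    (νM : M → ℝ) (νN : N → ℝ)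
    (hνM : IsPiAdicNorm π ρ νM) (hνN : IsPiAdicNorm π ρ νN) :
    (∀ (v : TensorProduct R M N) (l : ℕ),
      tensorSeminorm νM νN v ≤ ρ ^ l ↔ ∃ w : TensorProduct R M N, v = π ^ l • w) ∧
    (∀ v : TensorProduct R M N,
      tensorSeminorm νM νN (π • v) = ρ * tensorSeminorm νM νN v) := by
  refine ⟨fun v l => ⟨fun h => ?_, ?_⟩, fun v => ?_⟩
  · rcases l with _ | l
    · exact ⟨v, by simp⟩
    · by_contra hc
      have h1 := le_seminorm hρ0 hρ1 hνM hνN v l hc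
      have h2 : ρ ^ (l + 1) < ρ ^ l := pow_lt_pow_right_of_lt_one₀ hρ0 hρ1 (Nat.lt_succ_self l)
      linarith
  · rintro ⟨w, rfl⟩
    exact seminorm_le hρ0 hρ1 hνM hνN w l
  · rcases exists_max_pow π v with h | ⟨l, ⟨w, hw⟩, h2⟩
    · rw [seminorm_eq_zero hρ0 hρ1 hνM hνN v h, seminorm_eq_zero hρ0 hρ1 hνM hνN, mul_zero]
      intro l
      obtain ⟨w, hw⟩ := h l
      exact ⟨π • w, by rw [hw, smul_comm]⟩
    · have e1 : tensorSeminorm νM νN v = ρ ^ l :=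
        le_antisymm (hw ▸ seminorm_le hρ0 hρ1 hνM hνN w l) (le_seminorm hρ0 hρ1 hνM hνN v l h2)
      have e2 : tensorSeminorm νM νN (π • v) = ρ ^ (l + 1) := by
        apply le_antisymm
        · rw [hw, smul_smul, ← pow_succ']
          exact seminorm_le hρ0 hρ1 hνM hνN w (l + 1)
        · apply le_seminorm hρ0 hρ1 hνM hνN
          rintro ⟨u, hu⟩
          apply h2
          refine ⟨u, sub_eq_zero.1 (hT _ ?_)⟩
          rw [smul_sub, hu, smul_smul, ← pow_succ', sub_self]
      rw [e1, e2, pow_succ']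
end

section
/- Let R be a commutative ring with an element π and a real number ρ ∈ (0,1) such that R is π-torsion free and carries a π-adic norm relative to ρ. Let V be any set and let c₀(V,R) denote the R-module of functions x : V → R such that for every ε > 0 the set {v ∈ V : ‖x(v)‖ ≥ ε} is finite, equipped with the supremum norm ‖x‖ = sup_{v ∈ V} ‖x(v)‖. Then c₀(V,R) is π-torsion free and its supremum norm is π-adic: for every x ∈ c₀(V,R) and every l ≥ 0, ‖x‖ ≤ ρ^l if and only if x ∈ π^l · c₀(V,R). -/
/-- `x : V → R` belongs to `c₀(V,R)` iff for every `ε > 0` only finitely many of its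
values have norm at least `ε`. -/
def MemC0 {R : Type*} (ν : R → ℝ) {V : Type*} (x : V → R) : Prop :=
  ∀ ε : ℝ, 0 < ε → {v : V | ε ≤ ν (x v)}.Finite

theorem aux_exists {R : Type*} [CommRing R] {π : R} {ρ : ℝ} {ν : R → ℝ}
    (hν : IsPiAdicNorm π ρ ν) (r : R) (hr : r ≠ 0) :
    ∃ k : ℕ, (∃ s, r = π ^ k * s) ∧ (¬ ∃ s, r = π ^ (k + 1) * s) ∧ ν r = ρ ^ k := by
  classical
  obtain ⟨h1, h2, h3⟩ := hν
  have hex : ∃ k : ℕ, ¬ ∃ s, r = π ^ k • s := by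
    by_contra h
    push Not at h
    exact hr (h3 r h)
  have hs := Nat.find_spec hex
  have hm := fun m => @Nat.find_min _ _ hex m
  generalize Nat.find hex = k at hs hm
  cases k with
  | zero => exact absurd ⟨r, by simp⟩ hs
  | succ k =>
    have h := not_not.1 (hm k (Nat.lt_succ_self k))
    exact ⟨k, h, hs, h1 r k h hs⟩

theorem aux_le {R : Type*} [CommRing R] {π : R} {ρ : ℝ} (hρ0 : 0 < ρ) (hρ1 : ρ < 1)
    {ν : R → ℝ} (hν : IsPiAdicNorm π ρ ν) (r : R) (l : ℕ) :
    ν r ≤ ρ ^ l ↔ ∃ s, r = π ^ l * s := by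
  by_cases hr : r = 0
  · rw [(hν.2.1 r).2 hr]
    exact ⟨fun _ => ⟨0, by simp [hr]⟩, fun _ => by positivity⟩
  obtain ⟨k, ⟨s, hs⟩, hn, he⟩ := aux_exists hν r hr
  rw [he, pow_le_pow_iff_right_of_lt_one₀ hρ0 hρ1]
  constructor
  · intro h
    obtain ⟨d, rfl⟩ := Nat.exists_eq_add_of_le h
    exact ⟨π ^ d * s, by rw [hs]; ring⟩
  · rintro ⟨t, ht⟩
    by_contra h
    obtain ⟨d, rfl⟩ := Nat.exists_eq_add_of_le (show k + 1 ≤ l by omega)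
    exact hn ⟨π ^ d * t, by rw [ht]; ring⟩

theorem aux_cancel {R : Type*} [CommRing R] {π : R}
    (hR : ∀ r : R, π * r = 0 → r = 0) (l : ℕ) : ∀ r : R, π ^ l * r = 0 → r = 0 := by
  induction l with
  | zero => intro r h; simpa using h
  | succ l ih =>
    intro r h
    exact hR r (ih _ (by rw [← h]; ring))

theorem aux_mul {R : Type*} [CommRing R] {π : R} {ρ : ℝ}
    (hR : ∀ r : R, π * r = 0 → r = 0) {ν : R → ℝ} (hν : IsPiAdicNorm π ρ ν)
    (s : R) (l : ℕ) : ν (π ^ l * s) = ρ ^ l * ν s := by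
  have h0 : ν 0 = 0 := (hν.2.1 0).2 rfl
  by_cases hs0 : s = 0
  · simp [hs0, h0]
  obtain ⟨k, ⟨t, ht⟩, hn, he⟩ := aux_exists hν s hs0
  rw [he, ← pow_add]
  refine hν.1 _ _ ⟨t, by rw [smul_eq_mul, ht]; ring⟩ ?_
  rintro ⟨u, hu⟩
  refine hn ⟨u, sub_eq_zero.1 (aux_cancel hR l _ ?_)⟩
  rw [mul_sub, hu, smul_eq_mul]
  ring

/-- Let `R` be a `π`-torsion-free commutative ring with a `π`-adic norm
`ν` relative to `ρ ∈ (0,1)`, and let `V` be any set.  Then the `R`-module `c₀(V,R)` of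
functions tending to zero is `π`-torsion free, and its supremum norm
`‖x‖ = ⨆ v, ν (x v)` is `π`-adic: `‖x‖ ≤ ρ ^ l ↔ x ∈ π ^ l • c₀(V,R)`. -/
theorem stmt12 {R : Type*} [CommRing R] (π : R) (ρ : ℝ) (hρ0 : 0 < ρ) (hρ1 : ρ < 1)
    (hR : ∀ r : R, π * r = 0 → r = 0) (ν : R → ℝ) (hν : IsPiAdicNorm π ρ ν)
    (V : Type*) :
    (∀ x : V → R, MemC0 ν x → π • x = 0 → x = 0) ∧
    (∀ x : V → R, MemC0 ν x → ∀ l : ℕ,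
      ((⨆ v : V, ν (x v)) ≤ ρ ^ l ↔
        ∃ y : V → R, MemC0 ν y ∧ x = π ^ l • y)) := by
  refine ⟨fun x _ h => funext fun v => hR _ (congrFun h v), fun x hx l => ?_⟩
  have hle := aux_le hρ0 hρ1 hν
  constructor
  · intro h
    have hb : BddAbove (Set.range fun v => ν (x v)) := by
      refine ⟨1, ?_⟩
      rintro _ ⟨v, rfl⟩
      simpa using (hle (x v) 0).2 ⟨x v, by simp⟩
    choose y hy using fun v => (hle (x v) l).1 ((le_ciSup hb v).trans h)
    refine ⟨y, fun ε hε => ?_, funext hy⟩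
    refine (hx (ρ ^ l * ε) (by positivity)).subset fun v hv => ?_
    simp only [Set.mem_setOf_eq] at hv ⊢
    rw [hy v, aux_mul hR hν]
    gcongr
  · rintro ⟨y, _, rfl⟩
    exact Real.iSup_le (fun v => (hle _ l).2 ⟨y v, rfl⟩) (by positivity)
end
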